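/- arXiv:0811.4079 — 2 statements merged into one kernel-verified Lean document; each statement's English description precedes it below -/
import Mathlib

section
/- Strong Markov property of the conditioned laws: let U ⊆ ℝ^d be open, x ∈ U and t > 0 with W_x(τ_U > t) > 0. For any optional time τ (i.e. {τ < s} ∈ F_s for all s ≥ 0), any A ∈ F_{τ+} := {A ∈ F : ∀ s ≥ 0, A ∩ {τ < s} ∈ F_s}, and any nonnegative measurable function f(s, w) : [0,∞) × C_∞ → [0,∞], one has W̃^U_{x,t}(1_A · 1_{τ < t} · f(τ, θ_τ ·)) = W̃^U_{x,t}(1_A · 1_{τ < t} · g(τ, X_τ)), where g(s, y) = W̃^U_{y, t−s}(f(s, ·)) (which is W̃^U_{x,t}-a.s. well defined on {τ < t}). -/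
open MeasureTheory ProbabilityTheory Filter Topology NNReal ENNReal

noncomputable section

abbrev E (d : ℕ) : Type := EuclideanSpace ℝ (Fin d)

abbrev PathSpace (d : ℕ) : Type := C(ℝ≥0, E d)

instance (d : ℕ) : MeasurableSpace (PathSpace d) := borel _
instance (d : ℕ) : BorelSpace (PathSpace d) := ⟨rfl⟩

/-- `W` is the family of laws of standard `d`-dimensional Brownian motion:
`W x` is a probability measure on path space, starting a.s. at `x`, whose
increments have the finite-dimensional distributions of Brownian motion
(independent centered Gaussian coordinates with the right variances). -/
def IsWiener {d : ℕ} (W : E d → Measure (PathSpace d)) : Prop :=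
  ∀ x : E d, IsProbabilityMeasure (W x) ∧ (W x) {w | w 0 = x} = 1 ∧
    ∀ (n : ℕ) (t : Fin (n + 1) → ℝ≥0), Monotone t →
      (W x).map (fun w (p : Fin n × Fin d) => w (t p.1.succ) p.2 - w (t p.1.castSucc) p.2)
        = Measure.pi (fun p : Fin n × Fin d => gaussianReal 0 (t p.1.succ - t p.1.castSucc))

/-- First exit time from `U` : `τ_U = inf {t > 0 : X_t ∉ U}` (with value `∞` if the
path never leaves `U`). -/
def exitTime {d : ℕ} (U : Set (E d)) (w : PathSpace d) : ℝ≥0∞ :=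
  sInf (((↑) : ℝ≥0 → ℝ≥0∞) '' {t : ℝ≥0 | 0 < t ∧ w t ∉ U})

/-- The law `W̃^U_{x,1}` of Brownian motion started at `x` conditioned to stay in `U`
for a unit of time. -/
def condLaw {d : ℕ} (W : E d → Measure (PathSpace d)) (U : Set (E d)) (x : E d) :
    Measure (PathSpace d) :=
  ProbabilityTheory.cond (W x) {w | 1 < exitTime U w}


/-- `W̃^U_{x,t}` for a real time `t`, with the convention `W̃^U_{x,t} = W_x` for `t ≤ 0`. -/
def condLawT {d : ℕ} (W : E d → Measure (PathSpace d)) (U : Set (E d)) (x : E d) (t : ℝ) :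
    Measure (PathSpace d) :=
  if t ≤ 0 then W x
  else ProbabilityTheory.cond (W x) {w | ENNReal.ofReal t < exitTime U w}

/-- The natural filtration `F_t = σ(X_s, s ≤ t)` on path space. -/
def natFiltration (d : ℕ) (t : ℝ≥0) : MeasurableSpace (PathSpace d) :=
  ⨆ s : {s : ℝ≥0 // s ≤ t}, MeasurableSpace.comap (fun w : PathSpace d => w s.1) inferInstance

/-- The shift operator `θ_t`, `θ_t(w)(s) = w(t + s)`. -/
def shift {d : ℕ} (t : ℝ≥0) (w : PathSpace d) : PathSpace d :=
  w.comp ⟨fun s => t + s, by fun_prop⟩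

lemma measurableSet_forall_mem_of_isCompact {d : ℕ} (m : MeasurableSpace (PathSpace d))
    {K : Set ℝ≥0} (hK : IsCompact K) {V : Set (E d)} (hV : IsOpen V)
    (hm : ∀ s ∈ K, Measurable[m] fun w : PathSpace d => w s) :
    MeasurableSet[m] {w : PathSpace d | ∀ s ∈ K, w s ∈ V} := by
  obtain ⟨D, hDc, hD⟩ := TopologicalSpace.exists_countable_dense K
  have key : {w : PathSpace d | ∀ s ∈ K, w s ∈ V}
      = ⋃ n : ℕ, ⋂ s ∈ D, {w : PathSpace d | ((n : ℝ≥0∞))⁻¹ ≤ Metric.infEDist (w s) Vᶜ} := by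
    ext w
    simp only [Set.mem_ofPred_eq, Set.mem_iUnion, Set.mem_iInter]
    constructor
    · intro h
      rcases K.eq_empty_or_nonempty with rfl | hne
      · exact ⟨0, fun s => (Set.notMem_empty _ s.2).elim⟩
      have hcont : Continuous fun s : ℝ≥0 => Metric.infEDist (w s) Vᶜ :=
        Metric.continuous_infEDist.comp w.continuous
      obtain ⟨s₀, hs₀, hmin⟩ := hK.exists_isMinOn hne hcont.continuousOn
      have hpos : Metric.infEDist (w s₀) Vᶜ ≠ 0 := fun h0 =>
        ((Metric.mem_iff_infEDist_zero_of_closed hV.isClosed_compl).2 h0) (h s₀ hs₀)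
      obtain ⟨n, hn⟩ := ENNReal.exists_inv_nat_lt hpos
      exact ⟨n, fun s _ => hn.le.trans (hmin s.2)⟩
    · rintro ⟨n, hn⟩ s hs
      have hcl : IsClosed {s : K | ((n : ℝ≥0∞))⁻¹ ≤ Metric.infEDist (w s) Vᶜ} :=
        isClosed_le continuous_const
          (Metric.continuous_infEDist.comp (w.continuous.comp continuous_subtype_val))
      have hmem : (⟨s, hs⟩ : K) ∈ {s : K | ((n : ℝ≥0∞))⁻¹ ≤ Metric.infEDist (w s) Vᶜ} :=
        hcl.closure_subset_iff.2 (fun r hr => hn r hr) (hD _)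
      by_contra hsV
      have h0 : Metric.infEDist (w s) Vᶜ = 0 := Metric.infEDist_zero_of_mem hsV
      simp only [Set.mem_ofPred_eq, h0] at hmem
      simp at hmem
  rw [key]
  refine MeasurableSet.iUnion fun n => MeasurableSet.biInter hDc fun s _ => ?_
  have : Measurable[m] fun w : PathSpace d => Metric.infEDist (w s) Vᶜ :=
    Metric.continuous_infEDist.measurable.comp (hm s s.2)
  exact this measurableSet_Ici

lemma pathSpace_measurableSpace_eq_comap (d : ℕ) :
    (inferInstance : MeasurableSpace (PathSpace d))
      = MeasurableSpace.comap (fun (w : PathSpace d) (s : ℝ≥0) => w s) MeasurableSpace.pi := by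
  apply le_antisymm
  · change borel _ ≤ _
    rw [borel_eq_generateFrom_of_subbasis ContinuousMap.compactOpen_eq]
    refine MeasurableSpace.generateFrom_le ?_
    rintro _ ⟨K, hK, V, hV, rfl⟩
    exact measurableSet_forall_mem_of_isCompact _ hK hV fun s _ =>
      (measurable_pi_apply s).comp (comap_measurable _)
  · rw [← measurable_iff_comap_le]
    exact measurable_pi_lambda _ fun s => (continuous_eval_const s).measurable

lemma measurable_pathSpace_eval {d : ℕ} (s : ℝ≥0) :
    Measurable fun w : PathSpace d => w s :=
  (continuous_eval_const s).measurable

lemma natFiltration_eq_comap {d : ℕ} (r : ℝ≥0) :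
    natFiltration d r = MeasurableSpace.comap
      (fun (w : PathSpace d) (s : {s : ℝ≥0 // s ≤ r}) => w s.1) MeasurableSpace.pi := by
  simp only [natFiltration, MeasurableSpace.pi, MeasurableSpace.comap_iSup,
    MeasurableSpace.comap_comp]
  rfl

lemma natFiltration_le {d : ℕ} (r : ℝ≥0) :
    natFiltration d r ≤ (inferInstance : MeasurableSpace (PathSpace d)) :=
  iSup_le fun s => (measurable_pathSpace_eval s.1).comap_le

lemma natFiltration_mono {d : ℕ} {r s : ℝ≥0} (h : r ≤ s) :
    natFiltration d r ≤ natFiltration d s :=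
  iSup_le fun u => le_iSup_of_le (⟨u.1, u.2.trans h⟩ : {u : ℝ≥0 // u ≤ s}) le_rfl

lemma measurable_natFiltration_eval {d : ℕ} {r s : ℝ≥0} (h : s ≤ r) :
    Measurable[natFiltration d r] fun w : PathSpace d => w s :=
  measurable_iff_comap_le.2
    (le_iSup (fun s : {s : ℝ≥0 // s ≤ r} => MeasurableSpace.comap
      (fun w : PathSpace d => w s.1) inferInstance) ⟨s, h⟩)

lemma measurable_eval_sub_of_increments {d n : ℕ} {m : MeasurableSpace (PathSpace d)}
    (t : Fin (n + 1) → ℝ≥0) (a b : Fin (n + 1)) (hab : a ≤ b)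
    (hm : ∀ p : Fin n × Fin d, a ≤ p.1.castSucc → p.1.succ ≤ b →
      Measurable[m] fun w : PathSpace d => w (t p.1.succ) p.2 - w (t p.1.castSucc) p.2) :
    Measurable[m] fun w : PathSpace d => w (t b) - w (t a) := by
  induction b using Fin.induction with
  | zero =>
    obtain rfl : a = 0 := Fin.le_zero_iff.1 hab
    simp
  | succ i ih =>
    rcases hab.eq_or_lt with rfl | hlt
    · simp
    have hai : a ≤ i.castSucc := Fin.le_castSucc_iff.2 hlt
    have h1 := ih hai fun p hp1 hp2 => hm p hp1 (hp2.trans i.castSucc_lt_succ.le)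
    have h2 : Measurable[m] fun w : PathSpace d => w (t i.succ) - w (t i.castSucc) := by
      have h3 : Measurable[m] fun (w : PathSpace d) (c : Fin d) =>
          w (t i.succ) c - w (t i.castSucc) c :=
        measurable_pi_lambda _ fun c => hm (i, c) hai le_rfl
      exact (MeasurableEquiv.toLp 2 (Fin d → ℝ)).measurable.comp h3
    convert h2.add h1 using 2 with w
    simp

lemma exists_strictMono_range_eq (K : Finset ℝ≥0) (hK : K.Nonempty) :
    ∃ (n : ℕ) (t : Fin (n + 1) → ℝ≥0), StrictMono t ∧ ∀ s ∈ K, ∃ k, t k = s := by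
  have hc : K.card = (K.card - 1) + 1 := by have := hK.card_pos; omega
  refine ⟨K.card - 1, K.orderEmbOfFin hc, (K.orderEmbOfFin hc).strictMono, fun s hs => ?_⟩
  have : s ∈ Set.range (K.orderEmbOfFin hc) := by
    rw [Finset.range_orderEmbOfFin]; exact hs
  exact this

/-- The increments of a path along a finite sequence of times, coordinate by coordinate. -/
def increments {d n : ℕ} (t : Fin (n + 1) → ℝ≥0) (w : PathSpace d) (p : Fin n × Fin d) : ℝ :=
  w (t p.1.succ) p.2 - w (t p.1.castSucc) p.2

lemma measurable_increments_apply {d n : ℕ} (t : Fin (n + 1) → ℝ≥0) (p : Fin n × Fin d) :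
    Measurable fun w : PathSpace d => increments t w p := by
  have h (s : ℝ≥0) : Measurable fun w : PathSpace d => w s p.2 :=
    (by fun_prop : Measurable fun v : E d => v p.2).comp (measurable_pathSpace_eval s)
  exact (h _).sub (h _)

lemma measurable_increments {d n : ℕ} (t : Fin (n + 1) → ℝ≥0) :
    Measurable (increments (d := d) t) :=
  measurable_pi_lambda _ fun p => measurable_increments_apply t p

lemma measurable_comap_increments_eval_sub {d n : ℕ} (t : Fin (n + 1) → ℝ≥0)
    (S : Finset (Fin n × Fin d)) (a b : Fin (n + 1)) (hab : a ≤ b)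
    (hS : ∀ p : Fin n × Fin d, a ≤ p.1.castSucc → p.1.succ ≤ b → p ∈ S) :
    Measurable[MeasurableSpace.comap (fun (w : PathSpace d) (p : S) => increments t w p)
      MeasurableSpace.pi] fun w : PathSpace d => w (t b) - w (t a) :=
  measurable_eval_sub_of_increments t a b hab fun p hp hp' =>
    (measurable_pi_apply (⟨p, hS p hp hp'⟩ : S)).comp
      (comap_measurable (fun (w : PathSpace d) (p : S) => increments t w p))

/-- A law on path space started at the origin is determined by the laws of its increments. -/
lemma measure_eq_of_map_increments_eq {d : ℕ} {P Q : Measure (PathSpace d)}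
    [IsProbabilityMeasure P] [IsProbabilityMeasure Q]
    (hP : ∀ᵐ w ∂P, w 0 = 0) (hQ : ∀ᵐ w ∂Q, w 0 = 0)
    (h : ∀ (n : ℕ) (t : Fin (n + 1) → ℝ≥0), Monotone t →
      P.map (increments t) = Q.map (increments t)) : P = Q := by
  have hmeas : Measurable fun (w : PathSpace d) (s : ℝ≥0) => w s :=
    measurable_pi_lambda _ measurable_pathSpace_eval
  have hfin (I : Finset ℝ≥0) : P.map (fun w => I.restrict (fun s => w s))
      = Q.map (fun w => I.restrict (fun s => w s)) := by
    have hcongr (ν : Measure (PathSpace d)) (hν : ∀ᵐ w ∂ν, w 0 = 0) :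
        ν.map (fun w => I.restrict (fun s => w s))
          = ν.map (fun w => I.restrict (fun s => w s - w 0)) := by
      refine Measure.map_congr ?_
      filter_upwards [hν] with w hw
      simp [hw]
    rw [hcongr P hP, hcongr Q hQ]
    obtain ⟨n, t, ht, htK⟩ := exists_strictMono_range_eq (insert 0 I) (by simp)
    obtain ⟨a, ha⟩ := htK 0 (by simp)
    have hcomap : Measurable[MeasurableSpace.comap (increments t) MeasurableSpace.pi]
        fun w : PathSpace d => I.restrict (fun s => w s - w 0) := by
      refine @measurable_pi_lambda _ _ _
        (MeasurableSpace.comap (increments t) MeasurableSpace.pi) _ _ fun i => ?_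
      obtain ⟨k, hk⟩ := htK i (Finset.mem_insert_of_mem i.2)
      have hak : a ≤ k := ht.le_iff_le.1 (by rw [ha]; exact zero_le)
      have := measurable_eval_sub_of_increments
        (m := MeasurableSpace.comap (increments (d := d) t) MeasurableSpace.pi) t a k hak
        fun p _ _ => (measurable_pi_apply p).comp (comap_measurable (increments t))
      simpa [ha, hk] using this
    have hmI : Measurable fun w : PathSpace d => I.restrict (fun s => w s - w 0) :=
      hcomap.mono (measurable_increments t).comap_le le_rfl
    ext S hS
    rw [Measure.map_apply hmI hS, Measure.map_apply hmI hS]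
    obtain ⟨T, hT, hTS⟩ := hcomap hS
    rw [← hTS, ← Measure.map_apply (measurable_increments t) hT,
      ← Measure.map_apply (measurable_increments t) hT, h n t ht.monotone]
  have hmap : P.map (fun (w : PathSpace d) (s : ℝ≥0) => w s)
      = Q.map (fun (w : PathSpace d) (s : ℝ≥0) => w s) := by
    have hQl := isProjectiveLimit_map (P := Q) (X := fun (s : ℝ≥0) (w : PathSpace d) => w s)
      hmeas.aemeasurable
    have hPl := isProjectiveLimit_map (P := P) (X := fun (s : ℝ≥0) (w : PathSpace d) => w s)
      hmeas.aemeasurable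
    have : (fun I : Finset ℝ≥0 => P.map (fun w => I.restrict (fun s => w s)))
        = fun I : Finset ℝ≥0 => Q.map (fun w => I.restrict (fun s => w s)) := funext hfin
    have hfm (I : Finset ℝ≥0) : IsFiniteMeasure (Q.map (fun w => I.restrict (fun s => w s))) :=
      inferInstance
    exact IsProjectiveLimit.unique (this ▸ hPl) hQl
  ext S hS
  have hS' : MeasurableSet[inferInstance] S := hS
  rw [pathSpace_measurableSpace_eq_comap d] at hS'
  obtain ⟨T, hT, rfl⟩ := hS'
  rw [← Measure.map_apply hmeas hT, ← Measure.map_apply hmeas hT, hmap]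

/-- The path after time `r`, recentred so as to start at the origin. -/
def incrementPath {d : ℕ} (r : ℝ≥0) (w : PathSpace d) : PathSpace d :=
  shift r w - ContinuousMap.const _ (w r)

lemma incrementPath_apply {d : ℕ} (r s : ℝ≥0) (w : PathSpace d) :
    incrementPath r w s = w (r + s) - w r := rfl

lemma shift_eq_const_add_incrementPath {d : ℕ} (r : ℝ≥0) (w : PathSpace d) :
    shift r w = ContinuousMap.const _ (w r) + incrementPath r w := by
  simp [incrementPath]

lemma continuous_uncurry_eval (d : ℕ) :
    Continuous fun p : ℝ≥0 × PathSpace d => p.2 p.1 := by fun_prop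

lemma continuous_uncurry_shift (d : ℕ) :
    Continuous fun p : ℝ≥0 × PathSpace d => shift p.1 p.2 := by
  refine ContinuousMap.continuous_of_continuous_uncurry _ ?_
  change Continuous fun q : (ℝ≥0 × PathSpace d) × ℝ≥0 => q.1.2 (q.1.1 + q.2)
  fun_prop

lemma continuous_uncurry_incrementPath (d : ℕ) :
    Continuous fun p : ℝ≥0 × PathSpace d => incrementPath p.1 p.2 :=
  (continuous_uncurry_shift d).sub
    (ContinuousMap.continuous_const'.comp (continuous_uncurry_eval d))

lemma measurable_incrementPath {d : ℕ} (r : ℝ≥0) :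
    Measurable (incrementPath (d := d) r) :=
  ((continuous_uncurry_incrementPath d).comp (by fun_prop : Continuous fun w => (r, w))).measurable

namespace IsWiener

variable {d : ℕ} {W : E d → Measure (PathSpace d)}

lemma isProbabilityMeasure (hW : IsWiener W) (x : E d) : IsProbabilityMeasure (W x) := (hW x).1

lemma ae_eval_zero (hW : IsWiener W) (x : E d) : ∀ᵐ w ∂(W x), w 0 = x := by
  have := hW.isProbabilityMeasure x
  refine (prob_compl_eq_zero_iff ?_).2 (hW x).2.1
  exact measurable_pathSpace_eval 0 (measurableSet_singleton x)

lemma map_increments (hW : IsWiener W) (x : E d) {n : ℕ} {t : Fin (n + 1) → ℝ≥0}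
    (ht : Monotone t) : (W x).map (increments t)
      = Measure.pi (fun p : Fin n × Fin d => gaussianReal 0 (t p.1.succ - t p.1.castSucc)) :=
  (hW x).2.2 n t ht

lemma map_incrementPath (hW : IsWiener W) (x : E d) (r : ℝ≥0) :
    (W x).map (incrementPath r) = W 0 := by
  have := hW.isProbabilityMeasure
  have : IsProbabilityMeasure ((W x).map (incrementPath r)) :=
    Measure.isProbabilityMeasure_map (measurable_incrementPath r).aemeasurable
  refine measure_eq_of_map_increments_eq ?_ (hW.ae_eval_zero 0) fun n t ht => ?_
  · refine (ae_map_iff (measurable_incrementPath r).aemeasurable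
      (measurable_pathSpace_eval 0 (measurableSet_singleton 0))).2 ?_
    simp [incrementPath_apply]
  · rw [Measure.map_map (measurable_increments t) (measurable_incrementPath r),
      hW.map_increments 0 ht]
    have hcomp : increments t ∘ incrementPath (d := d) r = increments (fun k => r + t k) := by
      ext w p
      simp [increments, incrementPath_apply]
    rw [hcomp, hW.map_increments x fun i j hij => by gcongr; exact ht hij]
    simp only [add_tsub_add_eq_tsub_left]

lemma iIndepFun_increments (hW : IsWiener W) (x : E d) {n : ℕ} {t : Fin (n + 1) → ℝ≥0}
    (ht : Monotone t) : iIndepFun (fun p w => increments t w p) (W x) := by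
  have := hW.isProbabilityMeasure x
  rw [iIndepFun_iff_map_fun_eq_pi_map fun p => (measurable_increments_apply t p).aemeasurable]
  have h := hW.map_increments x ht
  refine h.trans ?_
  congr 1
  ext1 p
  have hp : (fun w => increments t w p) = Function.eval p ∘ increments (d := d) t := rfl
  rw [hp, ← Measure.map_map (measurable_pi_apply p) (measurable_increments t), h,
    (measurePreserving_eval _ p).map_eq]

lemma indepFun_finite_past_increments (hW : IsWiener W) (x : E d) (r : ℝ≥0)
    (I : Finset {s : ℝ≥0 // s ≤ r}) (J : Finset ℝ≥0) :
    IndepFun (fun (w : PathSpace d) (s : I) => w s.1.1 - w 0 + x)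
      (fun (w : PathSpace d) (s : J) => w (r + s) - w r) (W x) := by
  classical
  obtain ⟨n, t, ht, htK⟩ := exists_strictMono_range_eq
    (insert 0 (insert r (I.image Subtype.val ∪ J.image (r + ·)))) (by simp)
  obtain ⟨a, ha⟩ := htK 0 (by simp)
  obtain ⟨b, hb⟩ := htK r (by simp)
  obtain ⟨S, hS⟩ : ∃ S : Finset (Fin n × Fin d), ∀ p, p ∈ S ↔ p.1.succ ≤ b :=
    ⟨Finset.univ.filter fun p => p.1.succ ≤ b, by simp⟩
  obtain ⟨T, hT⟩ : ∃ T : Finset (Fin n × Fin d), ∀ p, p ∈ T ↔ b ≤ p.1.castSucc :=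
    ⟨Finset.univ.filter fun p => b ≤ p.1.castSucc, by simp⟩
  have hST : Disjoint S T := Finset.disjoint_left.2 fun p hpS hpT =>
    absurd (((hS p).1 hpS).trans ((hT p).1 hpT)) (not_le.2 p.1.castSucc_lt_succ)
  have hind := (hW.iIndepFun_increments x ht.monotone).indepFun_finset S T hST
    (measurable_increments_apply t)
  rw [IndepFun_iff_Indep] at hind ⊢
  refine indep_of_indep_of_le_left (indep_of_indep_of_le_right hind ?_) ?_
  · rw [← measurable_iff_comap_le]
    refine @measurable_pi_lambda _ _ _ (MeasurableSpace.comap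
      (fun (w : PathSpace d) (p : T) => increments t w p) MeasurableSpace.pi) _ _ fun s => ?_
    obtain ⟨k, hk⟩ := htK (r + s) (by
      simp only [Finset.mem_insert, Finset.mem_union, Finset.mem_image]
      exact .inr (.inr (.inr ⟨s, s.2, rfl⟩)))
    have hbk : b ≤ k := ht.le_iff_le.1 (by rw [hb, hk]; exact le_self_add)
    have := measurable_comap_increments_eval_sub t T b k hbk fun p hp _ => (hT p).2 hp
    simpa only [hb, hk] using this
  · rw [← measurable_iff_comap_le]
    refine @measurable_pi_lambda _ _ _ (MeasurableSpace.comap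
      (fun (w : PathSpace d) (p : S) => increments t w p) MeasurableSpace.pi) _ _ fun s => ?_
    obtain ⟨k, hk⟩ := htK s.1 (by
      simp only [Finset.mem_insert, Finset.mem_union, Finset.mem_image]
      exact .inr (.inr (.inl ⟨s, s.2, rfl⟩)))
    have hak : a ≤ k := ht.le_iff_le.1 (by rw [ha]; exact zero_le)
    have hkb : k ≤ b := ht.le_iff_le.1 (by rw [hb, hk]; exact s.1.2)
    have := measurable_comap_increments_eval_sub t S a k hak fun p _ hp => (hS p).2 (hp.trans hkb)
    simpa only [ha, hk] using this.add_const x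

lemma indepFun_past_increments (hW : IsWiener W) (x : E d) (r : ℝ≥0) :
    IndepFun (fun (w : PathSpace d) (s : {s : ℝ≥0 // s ≤ r}) => w s.1)
      (fun (w : PathSpace d) (s : ℝ≥0) => w (r + s) - w r) (W x) := by
  have := hW.isProbabilityMeasure x
  have hm := measurable_pathSpace_eval (d := d)
  have hind : IndepFun (fun (w : PathSpace d) (s : {s : ℝ≥0 // s ≤ r}) => w s.1 - w 0 + x)
      (fun (w : PathSpace d) (s : ℝ≥0) => w (r + s) - w r) (W x) :=
    IndepFun.process_indepFun_process
      (X := fun (s : {s : ℝ≥0 // s ≤ r}) (w : PathSpace d) => w s.1 - w 0 + x)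
      (Y := fun (s : ℝ≥0) (w : PathSpace d) => w (r + s) - w r)
      (fun s => ((hm _).sub (hm _)).add_const _)
      (fun s => (hm _).sub (hm _)) (hW.indepFun_finite_past_increments x r)
  refine hind.congr ?_ ae_eq_rfl
  filter_upwards [hW.ae_eval_zero x] with w hw
  ext1 s
  simp [hw]

/-- The weak Markov property at a deterministic time. -/
lemma measure_inter_incrementPath_preimage (hW : IsWiener W) (x : E d) (r : ℝ≥0)
    {G T : Set (PathSpace d)} (hG : MeasurableSet[natFiltration d r] G) (hT : MeasurableSet T) :
    W x (G ∩ incrementPath r ⁻¹' T) = W x G * W 0 T := by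
  have hind := hW.indepFun_past_increments x r
  rw [IndepFun_iff_Indep, ← natFiltration_eq_comap] at hind
  rw [← hW.map_incrementPath x r, Measure.map_apply (measurable_incrementPath r) hT]
  refine (Indep_iff _ _ _).1 hind _ _ hG ?_
  have hT₀ : MeasurableSet[inferInstance] T := hT
  rw [pathSpace_measurableSpace_eq_comap d] at hT₀
  obtain ⟨T', hT', rfl⟩ := hT₀
  exact ⟨T', hT', rfl⟩

lemma map_const_add (hW : IsWiener W) (y : E d) :
    (W 0).map (fun v => ContinuousMap.const _ y + v) = W y := by
  have hadd : Measurable fun v : PathSpace d => ContinuousMap.const ℝ≥0 y + v :=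
    (by fun_prop : Continuous _).measurable
  rw [← hW.map_incrementPath y 0, Measure.map_map hadd (measurable_incrementPath 0)]
  refine (Measure.map_congr (g := id) ?_).trans Measure.map_id
  filter_upwards [hW.ae_eval_zero y] with w hw
  ext1 s
  simp [incrementPath_apply, hw]

lemma lintegral_eq_lintegral_const_add (hW : IsWiener W) (y : E d)
    {F : PathSpace d → ℝ≥0∞} (hF : Measurable F) :
    ∫⁻ w, F w ∂(W y) = ∫⁻ v, F (ContinuousMap.const _ y + v) ∂(W 0) := by
  have hadd : Measurable fun v : PathSpace d => ContinuousMap.const ℝ≥0 y + v :=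
    (by fun_prop : Continuous _).measurable
  rw [← hW.map_const_add y, lintegral_map hF hadd]

lemma measurable_const_add (d : ℕ) :
    Measurable fun p : (ℝ≥0 × E d) × PathSpace d =>
      (p.1.1, ContinuousMap.const ℝ≥0 p.1.2 + p.2) := by
  have : Continuous fun p : (ℝ≥0 × E d) × PathSpace d =>
      (p.1.1, ContinuousMap.const ℝ≥0 p.1.2 + p.2) :=
    (by fun_prop : Continuous fun p : (ℝ≥0 × E d) × PathSpace d => p.1.1).prodMk
      ((ContinuousMap.continuous_const'.comp (by fun_prop)).add (by fun_prop))
  exact this.measurable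

lemma measurable_lintegral (hW : IsWiener W) {F : ℝ≥0 × PathSpace d → ℝ≥0∞}
    (hF : Measurable F) :
    Measurable fun p : ℝ≥0 × E d => ∫⁻ w, F (p.1, w) ∂(W p.2) := by
  have := hW.isProbabilityMeasure 0
  have h : (fun p : ℝ≥0 × E d => ∫⁻ w, F (p.1, w) ∂(W p.2))
      = fun p => ∫⁻ v, F (p.1, ContinuousMap.const _ p.2 + v) ∂(W 0) :=
    funext fun p => hW.lintegral_eq_lintegral_const_add p.2 (hF.comp measurable_prodMk_left)
  rw [h]
  exact (hF.comp (measurable_const_add d)).lintegral_prod_right'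

lemma setLIntegral_incrementPath (hW : IsWiener W) (x : E d) (r : ℝ≥0) {G : Set (PathSpace d)}
    (hG : MeasurableSet[natFiltration d r] G) {Φ : E d × PathSpace d → ℝ≥0∞}
    (hΦ : Measurable Φ) :
    ∫⁻ w in G, Φ (w r, incrementPath r w) ∂(W x)
      = ∫⁻ w in G, ∫⁻ v, Φ (w r, v) ∂(W 0) ∂(W x) := by
  have := hW.isProbabilityMeasure
  have hr := measurable_pathSpace_eval (d := d) r
  have hi := measurable_incrementPath (d := d) r
  have hprod : ((W x).restrict G).map (fun w => (w r, incrementPath r w))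
      = (((W x).restrict G).map (fun w => w r)).prod (W 0) := by
    refine (Measure.prod_eq fun S T hS hT => ?_).symm
    rw [Measure.map_apply (hr.prodMk hi) (hS.prod hT), Measure.map_apply hr hS,
      Measure.restrict_apply ((hr.prodMk hi) (hS.prod hT)), Measure.restrict_apply (hr hS),
      ← hW.measure_inter_incrementPath_preimage x r
        ((measurable_natFiltration_eval le_rfl hS).inter hG) hT]
    congr 1
    ext w
    simp only [Set.mem_inter_iff, Set.mem_preimage, Set.mem_prod]
    tauto
  rw [← lintegral_map hΦ (hr.prodMk hi), hprod, lintegral_prod _ hΦ.aemeasurable,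
    lintegral_map hΦ.lintegral_prod_right' hr]

end IsWiener

/-- If `V n` is independent of `Y n` with law `P` for every `n`, and `Y n → Y`, `V n → V`
pointwise, then `V` is independent of `Y` with law `P`. -/
lemma map_prodMk_eq_prod_of_tendsto {Ω α β : Type*} {mΩ : MeasurableSpace Ω}
    [TopologicalSpace α] [TopologicalSpace.PseudoMetrizableSpace α] [SecondCountableTopology α]
    [MeasurableSpace α] [BorelSpace α]
    [TopologicalSpace β] [TopologicalSpace.PseudoMetrizableSpace β] [SecondCountableTopology β]
    [MeasurableSpace β] [BorelSpace β]
    {ν : Measure Ω} [IsFiniteMeasure ν] {P : Measure β} [IsProbabilityMeasure P]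
    {Y : Ω → α} {V : Ω → β} {Yn : ℕ → Ω → α} {Vn : ℕ → Ω → β}
    (hYn : ∀ n, Measurable (Yn n)) (hY : Measurable Y)
    (hVn : ∀ n, Measurable (Vn n)) (hV : Measurable V)
    (hYlim : ∀ ω, Tendsto (fun n => Yn n ω) atTop (𝓝 (Y ω)))
    (hVlim : ∀ ω, Tendsto (fun n => Vn n ω) atTop (𝓝 (V ω)))
    (h : ∀ n, ∀ Φ : α × β → ℝ≥0∞, Measurable Φ →
      ∫⁻ ω, Φ (Yn n ω, Vn n ω) ∂ν = ∫⁻ ω, ∫⁻ v, Φ (Yn n ω, v) ∂P ∂ν) :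
    ν.map (fun ω => (Y ω, V ω)) = (ν.map Y).prod P := by
  refine ext_of_forall_lintegral_eq_of_IsFiniteMeasure fun Φ => ?_
  have hΦcont : Continuous fun p => (Φ p : ℝ≥0∞) := ENNReal.continuous_coe.comp Φ.continuous
  have hΦ := hΦcont.measurable
  obtain ⟨C, hC⟩ : ∃ C : ℝ≥0, ∀ p, (Φ p : ℝ≥0∞) ≤ C :=
    ⟨_, fun p => ENNReal.coe_le_coe.2 (BoundedContinuousFunction.NNReal.upper_bound Φ p)⟩
  rw [lintegral_map hΦ (hY.prodMk hV), lintegral_prod _ hΦ.aemeasurable,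
    lintegral_map hΦ.lintegral_prod_right' hY]
  have hfin : ∫⁻ _, (C : ℝ≥0∞) ∂ν ≠ ⊤ := by
    rw [lintegral_const]
    exact ENNReal.mul_ne_top ENNReal.coe_ne_top (measure_ne_top _ _)
  have hlim1 := tendsto_lintegral_of_dominated_convergence (μ := ν) (fun _ => (C : ℝ≥0∞))
    (fun n => hΦ.comp ((hYn n).prodMk (hVn n))) (fun n => ae_of_all _ fun w => hC _) hfin
    (ae_of_all _ fun w => (hΦcont.tendsto _).comp ((hYlim w).prodMk_nhds (hVlim w)))
  have hlim2 := tendsto_lintegral_of_dominated_convergence (μ := ν) (fun _ => (C : ℝ≥0∞))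
    (fun n => hΦ.lintegral_prod_right'.comp (hYn n))
    (fun n => ae_of_all _ fun w => (lintegral_mono fun v => hC _).trans (by simp)) hfin
    (ae_of_all _ fun w => tendsto_lintegral_of_dominated_convergence (μ := P)
      (fun _ => (C : ℝ≥0∞)) (fun n => hΦ.comp measurable_prodMk_left)
      (fun n => ae_of_all _ fun v => hC _) (by simp)
      (ae_of_all _ fun v => (hΦcont.tendsto _).comp ((hYlim w).prodMk_nhds tendsto_const_nhds)))
  exact tendsto_nhds_unique hlim1 (hlim2.congr fun n => (h n _ hΦ).symm)

section OptionalTime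

variable {d : ℕ} {τ : PathSpace d → ℝ≥0∞}

lemma measurable_prodMk_eval {σ : PathSpace d → ℝ≥0} (hσ : Measurable σ) :
    Measurable fun w => (σ w, w (σ w)) :=
  hσ.prodMk ((continuous_uncurry_eval d).measurable.comp (hσ.prodMk measurable_id))

lemma measurable_incrementPath_time {σ : PathSpace d → ℝ≥0} (hσ : Measurable σ) :
    Measurable fun w => incrementPath (σ w) w :=
  (continuous_uncurry_incrementPath d).measurable.comp (hσ.prodMk measurable_id)

lemma measurable_of_optionalTime
    (hτ : ∀ s : ℝ≥0, MeasurableSet[natFiltration d s] {w | τ w < (s : ℝ≥0∞)}) :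
    Measurable τ := by
  refine measurable_of_Iio fun c => ?_
  induction c using ENNReal.recTopCoe with
  | coe s => exact natFiltration_le s _ (hτ s)
  | top =>
    have : τ ⁻¹' Set.Iio ⊤ = ⋃ n : ℕ, {w | τ w < ((n : ℝ≥0) : ℝ≥0∞)} := by
      ext w
      simp only [Set.mem_preimage, Set.mem_Iio, Set.mem_iUnion, Set.mem_ofPred_eq,
        ENNReal.coe_natCast]
      exact ⟨fun h => ENNReal.exists_nat_gt h.ne, fun ⟨n, hn⟩ => hn.trans (by simp)⟩
    rw [this]
    exact MeasurableSet.iUnion fun n => natFiltration_le _ _ (hτ n)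

/-- The approximation of `r` from above by multiples of `1 / (n + 1)`. -/
def gridApprox (n : ℕ) (r : ℝ≥0) : ℝ≥0 := (⌊((n : ℝ≥0) + 1) * r⌋₊ + 1 : ℝ≥0) / (n + 1)

lemma measurable_gridApprox (n : ℕ) : Measurable (gridApprox n) := by
  unfold gridApprox
  have : Measurable fun r : ℝ≥0 => ⌊((n : ℝ≥0) + 1) * r⌋₊ :=
    Nat.measurable_floor.comp (measurable_id.const_mul _)
  exact ((measurable_from_top.comp this).add_const _).div_const _

lemma tendsto_gridApprox (r : ℝ≥0) :
    Tendsto (fun n => gridApprox n r) atTop (𝓝 r) := by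
  have hlim : Tendsto (fun n : ℕ => r + 1 / ((n : ℝ≥0) + 1)) atTop (𝓝 r) := by
    simpa using tendsto_const_nhds.add (tendsto_one_div_add_atTop_nhds_zero_nat (𝕜 := ℝ≥0))
  refine tendsto_of_tendsto_of_tendsto_of_le_of_le tendsto_const_nhds hlim (fun n => ?_)
    fun n => ?_
  · have hn : (0 : ℝ≥0) < n + 1 := by positivity
    change r ≤ _ / _
    rw [le_div_iff₀ hn, mul_comm]
    exact (Nat.lt_floor_add_one _).le
  · have hn : (0 : ℝ≥0) < n + 1 := by positivity
    change _ / _ ≤ r + 1 / ((n : ℝ≥0) + 1)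
    rw [div_le_iff₀ hn, add_mul r, one_div, inv_mul_cancel₀ hn.ne', mul_comm r]
    gcongr
    exact Nat.floor_le zero_le

lemma floor_eq_iff_mem_Ico (n k : ℕ) (r : ℝ≥0) :
    ⌊((n : ℝ≥0) + 1) * r⌋₊ = k ↔ (k : ℝ≥0) / (n + 1) ≤ r ∧ r < ((k : ℝ≥0) + 1) / (n + 1) := by
  have hn : (0 : ℝ≥0) < n + 1 := by positivity
  rw [Nat.floor_eq_iff zero_le, div_le_iff₀ hn, lt_div_iff₀ hn, mul_comm r]

variable {W : E d → Measure (PathSpace d)}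

lemma IsWiener.setLIntegral_gridApprox (hW : IsWiener W) (x : E d)
    (hτ : ∀ s : ℝ≥0, MeasurableSet[natFiltration d s] {w | τ w < (s : ℝ≥0∞)})
    {A : Set (PathSpace d)}
    (hA : ∀ s : ℝ≥0, MeasurableSet[natFiltration d s] (A ∩ {w | τ w < (s : ℝ≥0∞)}))
    {Φ : (ℝ≥0 × E d) × PathSpace d → ℝ≥0∞} (hΦ : Measurable Φ) (n : ℕ) :
    ∫⁻ w in A ∩ {w | τ w < ⊤}, Φ ((gridApprox n (τ w).toNNReal,
        w (gridApprox n (τ w).toNNReal)), incrementPath (gridApprox n (τ w).toNNReal) w) ∂(W x)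
      = ∫⁻ w in A ∩ {w | τ w < ⊤}, ∫⁻ v, Φ ((gridApprox n (τ w).toNNReal,
        w (gridApprox n (τ w).toNNReal)), v) ∂(W 0) ∂(W x) := by
  let G (k : ℕ) : Set (PathSpace d) :=
    (A ∩ {w | τ w < ⊤}) ∩ {w | ⌊((n : ℝ≥0) + 1) * (τ w).toNNReal⌋₊ = k}
  have hGmeas (k : ℕ) : MeasurableSet[natFiltration d (((k : ℝ≥0) + 1) / (n + 1))] (G k) := by
    have hG : G k = (A ∩ {w | τ w < ((((k : ℝ≥0) + 1) / (n + 1) : ℝ≥0) : ℝ≥0∞)})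
        \ {w | τ w < (((k : ℝ≥0) / (n + 1) : ℝ≥0) : ℝ≥0∞)} := by
      ext w
      simp only [G, Set.mem_inter_iff, Set.mem_sdiff, Set.mem_ofPred_eq, floor_eq_iff_mem_Ico,
        not_lt]
      constructor
      · rintro ⟨⟨h1, h2⟩, h3, h4⟩
        lift τ w to ℝ≥0 using h2.ne with s
        exact ⟨⟨h1, by exact_mod_cast h4⟩, by exact_mod_cast h3⟩
      · rintro ⟨⟨h1, h4⟩, h3⟩
        have h2 : τ w < ⊤ := h4.trans ENNReal.coe_lt_top
        refine ⟨⟨h1, h2⟩, ?_⟩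
        lift τ w to ℝ≥0 using h2.ne with s
        exact ⟨by exact_mod_cast h3, by exact_mod_cast h4⟩
    rw [hG]
    refine MeasurableSet.diff (hA _) (natFiltration_mono ?_ _ (hτ _))
    gcongr
    exact le_self_add
  have hGdisj : Pairwise (Function.onFun Disjoint G) := fun i j hij =>
    Set.disjoint_left.2 fun w hi hj => hij (hi.2.symm.trans hj.2)
  have hGU : A ∩ {w | τ w < ⊤} = ⋃ k, G k := by
    ext w
    simp [G]
  rw [hGU, lintegral_iUnion (fun k => natFiltration_le _ _ (hGmeas k)) hGdisj,
    lintegral_iUnion (fun k => natFiltration_le _ _ (hGmeas k)) hGdisj]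
  congr 1
  ext1 k
  have hgrid : ∀ w ∈ G k, gridApprox n (τ w).toNNReal = ((k : ℝ≥0) + 1) / (n + 1) := by
    intro w hw
    have : ⌊((n : ℝ≥0) + 1) * (τ w).toNNReal⌋₊ = k := hw.2
    simp [gridApprox, this]
  have hGk := natFiltration_le _ _ (hGmeas k)
  have key := hW.setLIntegral_incrementPath x _ (hGmeas k)
    (Φ := fun p => Φ ((((k : ℝ≥0) + 1) / (n + 1), p.1), p.2)) (hΦ.comp (by fun_prop))
  refine (setLIntegral_congr_fun hGk fun w hw => ?_).trans
    (key.trans (setLIntegral_congr_fun hGk fun w hw => ?_))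
  · simp only [hgrid w hw]
  · simp only [hgrid w hw]

lemma continuous_incrementPath_time (w : PathSpace d) : Continuous fun r => incrementPath r w :=
  (continuous_uncurry_incrementPath d).comp (Continuous.prodMk_left w)

/-- At an optional time, the recentred future path is independent of the pre-time information
and has the law of Brownian motion started at the origin. -/
lemma IsWiener.map_incrementPath_optionalTime (hW : IsWiener W) (x : E d)
    (hτ : ∀ s : ℝ≥0, MeasurableSet[natFiltration d s] {w | τ w < (s : ℝ≥0∞)})
    {A : Set (PathSpace d)}
    (hA : ∀ s : ℝ≥0, MeasurableSet[natFiltration d s] (A ∩ {w | τ w < (s : ℝ≥0∞)})) :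
    ((W x).restrict (A ∩ {w | τ w < ⊤})).map
        (fun w => (((τ w).toNNReal, w (τ w).toNNReal), incrementPath (τ w).toNNReal w))
      = (((W x).restrict (A ∩ {w | τ w < ⊤})).map
        (fun w => ((τ w).toNNReal, w (τ w).toNNReal))).prod (W 0) := by
  have := hW.isProbabilityMeasure
  have hT : Measurable fun w => (τ w).toNNReal := (measurable_of_optionalTime hτ).ennreal_toNNReal
  have hTn (n : ℕ) : Measurable fun w => gridApprox n (τ w).toNNReal :=
    (measurable_gridApprox n).comp hT
  have hYlim (w : PathSpace d) : Tendsto (fun n => (gridApprox n (τ w).toNNReal,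
      w (gridApprox n (τ w).toNNReal))) atTop (𝓝 ((τ w).toNNReal, w (τ w).toNNReal)) :=
    (tendsto_gridApprox _).prodMk_nhds ((w.continuous.tendsto _).comp (tendsto_gridApprox _))
  have hVlim (w : PathSpace d) : Tendsto (fun n => incrementPath (gridApprox n (τ w).toNNReal) w)
      atTop (𝓝 (incrementPath (τ w).toNNReal w)) :=
    ((continuous_incrementPath_time w).tendsto _).comp (tendsto_gridApprox _)
  exact map_prodMk_eq_prod_of_tendsto (ν := (W x).restrict (A ∩ {w | τ w < ⊤})) (P := W 0)
    (Y := fun w => ((τ w).toNNReal, w (τ w).toNNReal))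
    (V := fun w => incrementPath (τ w).toNNReal w)
    (Yn := fun n w => (gridApprox n (τ w).toNNReal, w (gridApprox n (τ w).toNNReal)))
    (Vn := fun n w => incrementPath (gridApprox n (τ w).toNNReal) w)
    (fun n => measurable_prodMk_eval (hTn n)) (measurable_prodMk_eval hT)
    (fun n => measurable_incrementPath_time (hTn n)) (measurable_incrementPath_time hT)
    hYlim hVlim fun n Φ hΦ => hW.setLIntegral_gridApprox x hτ hA hΦ n

/-- The strong Markov property of Brownian motion. -/
lemma IsWiener.setLIntegral_shift_optionalTime (hW : IsWiener W) (x : E d)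
    (hτ : ∀ s : ℝ≥0, MeasurableSet[natFiltration d s] {w | τ w < (s : ℝ≥0∞)})
    {A : Set (PathSpace d)}
    (hA : ∀ s : ℝ≥0, MeasurableSet[natFiltration d s] (A ∩ {w | τ w < (s : ℝ≥0∞)}))
    {F : ℝ≥0 × PathSpace d → ℝ≥0∞} (hF : Measurable F) :
    ∫⁻ w in A ∩ {w | τ w < ⊤}, F ((τ w).toNNReal, shift (τ w).toNNReal w) ∂(W x)
      = ∫⁻ w in A ∩ {w | τ w < ⊤},
          ∫⁻ w', F ((τ w).toNNReal, w') ∂(W (w (τ w).toNNReal)) ∂(W x) := by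
  have := hW.isProbabilityMeasure
  have hT : Measurable fun w => (τ w).toNNReal := (measurable_of_optionalTime hτ).ennreal_toNNReal
  have hY := measurable_prodMk_eval hT
  have hV := measurable_incrementPath_time hT
  have hG := hF.comp (measurable_const_add d)
  have key := lintegral_map (μ := (W x).restrict (A ∩ {w | τ w < ⊤})) hG (hY.prodMk hV)
  rw [hW.map_incrementPath_optionalTime x hτ hA, lintegral_prod _ hG.aemeasurable,
    lintegral_map hG.lintegral_prod_right' hY] at key
  simp only [Function.comp_apply, ← shift_eq_const_add_incrementPath] at key
  rw [← key]
  refine lintegral_congr fun w => ?_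
  exact (hW.lintegral_eq_lintegral_const_add _ (hF.comp measurable_prodMk_left)).symm

end OptionalTime

section ExitTime

variable {d : ℕ} {U : Set (E d)}

lemma mem_of_lt_exitTime {w : PathSpace d} {q s : ℝ≥0} (h : (q : ℝ≥0∞) < exitTime U w)
    (hs : 0 < s) (hsq : s ≤ q) : w s ∈ U := by
  by_contra hsU
  have : exitTime U w ≤ (s : ℝ≥0∞) := sInf_le ⟨s, ⟨hs, hsU⟩, rfl⟩
  exact absurd (h.trans_le this) (not_lt.2 (by exact_mod_cast hsq))

lemma lt_exitTime_of_forall_mem (hU : IsOpen U) {w : PathSpace d} {q : ℝ≥0} (hq : w q ∈ U)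
    (h : ∀ s, 0 < s → s ≤ q → w s ∈ U) : (q : ℝ≥0∞) < exitTime U w := by
  have hnhds : ∀ᶠ s in 𝓝 q, w s ∈ U := w.continuous.continuousAt (hU.mem_nhds hq)
  obtain ⟨r, hqr, hr⟩ := exists_Ico_subset_of_mem_nhds hnhds ⟨q + 1, lt_add_one q⟩
  have hle : (r : ℝ≥0∞) ≤ exitTime U w := by
    refine le_sInf ?_
    rintro _ ⟨s, ⟨hs0, hsU⟩, rfl⟩
    by_contra! hsr
    have hsr' : s < r := by exact_mod_cast hsr
    rcases le_total s q with hsq | hsq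
    · exact hsU (h s hs0 hsq)
    · exact hsU (hr ⟨hsq, hsr'⟩)
  exact lt_of_lt_of_le (by exact_mod_cast hqr) hle

lemma lt_exitTime_iff (hU : IsOpen U) {w : PathSpace d} {q : ℝ≥0} (hq : 0 < q) :
    (q : ℝ≥0∞) < exitTime U w ↔ ∀ s, 0 < s → s ≤ q → w s ∈ U :=
  ⟨fun h _ hs hsq => mem_of_lt_exitTime h hs hsq,
    fun h => lt_exitTime_of_forall_mem hU (h q hq le_rfl) h⟩

lemma lt_exitTime_iff_shift (hU : IsOpen U) {w : PathSpace d} (hw : w 0 ∈ U) {r t : ℝ≥0}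
    (hrt : r < t) : (t : ℝ≥0∞) < exitTime U w ↔
      (r : ℝ≥0∞) < exitTime U w ∧ ((t - r : ℝ≥0) : ℝ≥0∞) < exitTime U (shift r w) := by
  have ht : 0 < t := zero_le.trans_lt hrt
  rw [lt_exitTime_iff hU ht, lt_exitTime_iff hU (tsub_pos_of_lt hrt)]
  constructor
  · intro h
    refine ⟨lt_exitTime_of_forall_mem hU ?_ fun s hs hsr => h s hs (hsr.trans hrt.le), ?_⟩
    · rcases (zero_le (a := r)).eq_or_lt with rfl | hr
      · exact hw
      · exact h r hr hrt.le
    · intro s hs hst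
      exact h (r + s) (add_pos_of_nonneg_of_pos zero_le hs)
        (by rwa [add_comm, ← le_tsub_iff_right hrt.le])
  · rintro ⟨h1, h2⟩ s hs hst
    rcases le_or_gt s r with hsr | hrs
    · exact mem_of_lt_exitTime h1 hs hsr
    · have := h2 (s - r) (tsub_pos_of_lt hrs) (tsub_le_tsub_right hst r)
      change w (r + (s - r)) ∈ U at this
      rwa [add_tsub_cancel_of_le hrs.le] at this

lemma measurableSet_lt_exitTime (hU : IsOpen U) {q : ℝ≥0} (hq : 0 < q) :
    MeasurableSet[natFiltration d q] {w | (q : ℝ≥0∞) < exitTime U w} := by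
  have : {w : PathSpace d | (q : ℝ≥0∞) < exitTime U w}
      = ⋂ n : ℕ, {w | ∀ s ∈ Set.Icc (1 / ((n : ℝ≥0) + 1)) q, w s ∈ U} := by
    ext w
    simp only [Set.mem_ofPred_eq, lt_exitTime_iff hU hq, Set.mem_iInter, Set.mem_Icc]
    constructor
    · intro h n s hs
      exact h s (lt_of_lt_of_le (by positivity) hs.1) hs.2
    · intro h s hs hsq
      obtain ⟨n, hn⟩ := exists_nat_one_div_lt hs
      exact h n s ⟨hn.le, hsq⟩
  rw [this]
  exact MeasurableSet.iInter fun n => measurableSet_forall_mem_of_isCompact _ isCompact_Icc hU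
    fun s hs => measurable_natFiltration_eval hs.2

lemma measurable_exitTime (hU : IsOpen U) : Measurable (exitTime (d := d) U) := by
  have h (c : ℝ≥0∞) : exitTime (d := d) U ⁻¹' Set.Ioi c
      = ⋃ q : ℚ, ⋃ _ : c < (Real.toNNReal q : ℝ≥0∞),
        {w | (Real.toNNReal q : ℝ≥0∞) < exitTime U w} := by
    ext w
    simp only [Set.mem_preimage, Set.mem_Ioi, Set.mem_iUnion, Set.mem_ofPred_eq, exists_prop]
    exact ⟨fun hc => (ENNReal.lt_iff_exists_rat_btwn.1 hc).imp fun q hq => hq.2,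
      fun ⟨q, h1, h2⟩ => h1.trans h2⟩
  refine measurable_of_Ioi fun c => ?_
  rw [h]
  refine MeasurableSet.iUnion fun q => MeasurableSet.iUnion fun hq => ?_
  exact natFiltration_le _ _
    (measurableSet_lt_exitTime hU (by exact_mod_cast zero_le.trans_lt hq))

lemma measurableSet_lt_exitTime_inter_lt (hU : IsOpen U) {τ : PathSpace d → ℝ≥0∞}
    (hτ : ∀ s : ℝ≥0, MeasurableSet[natFiltration d s] {w | τ w < (s : ℝ≥0∞)}) (s : ℝ≥0) :
    MeasurableSet[natFiltration d s] ({w | τ w < exitTime U w} ∩ {w | τ w < (s : ℝ≥0∞)}) := by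
  have h : {w | τ w < exitTime U w} ∩ {w | τ w < (s : ℝ≥0∞)}
      = ⋃ q : ℚ, ⋃ _ : 0 < Real.toNNReal q ∧ Real.toNNReal q < s,
        {w | τ w < (Real.toNNReal q : ℝ≥0∞)} ∩ {w | (Real.toNNReal q : ℝ≥0∞) < exitTime U w} := by
    ext w
    simp only [Set.mem_inter_iff, Set.mem_iUnion, Set.mem_ofPred_eq, exists_prop]
    constructor
    · intro hw
      obtain ⟨q, -, h1, h2⟩ := ENNReal.lt_iff_exists_rat_btwn.1 (lt_min hw.1 hw.2)
      exact ⟨q, ⟨by exact_mod_cast zero_le.trans_lt h1,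
        by exact_mod_cast h2.trans_le (min_le_right _ _)⟩, h1, h2.trans_le (min_le_left _ _)⟩
    · rintro ⟨q, ⟨-, hqs⟩, h1, h2⟩
      exact ⟨h1.trans h2, h1.trans (by exact_mod_cast hqs)⟩
  rw [h]
  refine MeasurableSet.iUnion fun q => MeasurableSet.iUnion fun hq => ?_
  exact natFiltration_mono hq.2.le _ ((hτ _).inter (measurableSet_lt_exitTime hU hq.1))

end ExitTime

section Conditioned

variable {d : ℕ} {U : Set (E d)} {W : E d → Measure (PathSpace d)} {τ : PathSpace d → ℝ≥0∞}

lemma measurableSet_inter_lt_exitTime_inter_lt (hU : IsOpen U)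
    (hτ : ∀ s : ℝ≥0, MeasurableSet[natFiltration d s] {w | τ w < (s : ℝ≥0∞)})
    {A : Set (PathSpace d)}
    (hA : ∀ s : ℝ≥0, MeasurableSet[natFiltration d s] (A ∩ {w | τ w < (s : ℝ≥0∞)}))
    (t s : ℝ≥0) :
    MeasurableSet[natFiltration d s]
      ((A ∩ {w | τ w < (t : ℝ≥0∞)} ∩ {w | τ w < exitTime U w}) ∩ {w | τ w < (s : ℝ≥0∞)}) := by
  have h : (A ∩ {w | τ w < (t : ℝ≥0∞)} ∩ {w | τ w < exitTime U w}) ∩ {w | τ w < (s : ℝ≥0∞)}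
      = (A ∩ {w | τ w < ((min t s : ℝ≥0) : ℝ≥0∞)})
        ∩ ({w | τ w < exitTime U w} ∩ {w | τ w < (s : ℝ≥0∞)}) := by
    ext w
    simp only [Set.mem_inter_iff, Set.mem_ofPred_eq, ENNReal.coe_min, lt_min_iff]
    tauto
  rw [h]
  exact (natFiltration_mono (min_le_right t s) _ (hA _)).inter
    (measurableSet_lt_exitTime_inter_lt hU hτ s)

lemma measurableSet_lt_exitTime_prod (hU : IsOpen U) (t : ℝ≥0) :
    MeasurableSet {p : ℝ≥0 × PathSpace d | ((t - p.1 : ℝ≥0) : ℝ≥0∞) < exitTime U p.2} :=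
  measurableSet_lt (measurable_fst.const_sub t).coe_nnreal_ennreal
    ((measurable_exitTime hU).comp measurable_snd)

/-- The strong Markov property on the event of survival up to time `t`. -/
lemma IsWiener.setLIntegral_shift_lt_exitTime (hW : IsWiener W) (hU : IsOpen U) {x : E d}
    (hx : x ∈ U) (hτ : ∀ s : ℝ≥0, MeasurableSet[natFiltration d s] {w | τ w < (s : ℝ≥0∞)})
    {A : Set (PathSpace d)}
    (hA : ∀ s : ℝ≥0, MeasurableSet[natFiltration d s] (A ∩ {w | τ w < (s : ℝ≥0∞)}))
    (t : ℝ≥0) {F : ℝ≥0 × PathSpace d → ℝ≥0∞} (hF : Measurable F) :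
    ∫⁻ w in (A ∩ {w | τ w < (t : ℝ≥0∞)}) ∩ {w | (t : ℝ≥0∞) < exitTime U w},
        F ((τ w).toNNReal, shift (τ w).toNNReal w) ∂(W x)
      = ∫⁻ w in A ∩ {w | τ w < (t : ℝ≥0∞)} ∩ {w | τ w < exitTime U w},
          ∫⁻ w' in {w' | ((t - (τ w).toNNReal : ℝ≥0) : ℝ≥0∞) < exitTime U w'},
            F ((τ w).toNNReal, w') ∂(W (w (τ w).toNNReal)) ∂(W x) := by
  have hS := measurableSet_lt_exitTime_prod hU t
  have hD (r : ℝ≥0) : MeasurableSet {w : PathSpace d | (r : ℝ≥0∞) < exitTime U w} :=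
    measurableSet_lt measurable_const (measurable_exitTime hU)
  have hA' := measurableSet_inter_lt_exitTime_inter_lt hU hτ hA t
  have hB : MeasurableSet (A ∩ {w | τ w < (t : ℝ≥0∞)}) := natFiltration_le _ _ (hA t)
  have hB' : MeasurableSet (A ∩ {w | τ w < (t : ℝ≥0∞)} ∩ {w | τ w < exitTime U w}) :=
    hB.inter (measurableSet_lt (measurable_of_optionalTime hτ) (measurable_exitTime hU))
  have htop : (A ∩ {w | τ w < (t : ℝ≥0∞)} ∩ {w | τ w < exitTime U w}) ∩ {w | τ w < ⊤}
      = A ∩ {w | τ w < (t : ℝ≥0∞)} ∩ {w | τ w < exitTime U w} :=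
    Set.inter_eq_left.2 fun w hw => lt_top_of_lt (show τ w < exitTime U w from hw.2)
  have key := hW.setLIntegral_shift_optionalTime x hτ hA' (hF.indicator hS)
  rw [htop] at key
  calc _ = ∫⁻ w in A ∩ {w | τ w < (t : ℝ≥0∞)} ∩ {w | τ w < exitTime U w},
        Set.indicator {p : ℝ≥0 × PathSpace d | ((t - p.1 : ℝ≥0) : ℝ≥0∞) < exitTime U p.2} F
          ((τ w).toNNReal, shift (τ w).toNNReal w) ∂(W x) := by
        rw [← lintegral_indicator (hB.inter (hD t)), ← lintegral_indicator hB']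
        refine lintegral_congr_ae ?_
        filter_upwards [hW.ae_eval_zero x] with w hw
        have hw0 : w 0 ∈ U := by rwa [hw]
        by_cases hwB : w ∈ A ∩ {w | τ w < (t : ℝ≥0∞)}
        · have hlt : τ w < (t : ℝ≥0∞) := hwB.2
          have hr : ((τ w).toNNReal : ℝ≥0∞) = τ w := ENNReal.coe_toNNReal (lt_top_of_lt hlt).ne
          have hrt : (τ w).toNNReal < t := by rwa [← ENNReal.coe_lt_coe, hr]
          have hiff := lt_exitTime_iff_shift hU hw0 hrt
          rw [hr] at hiff
          by_cases h1 : (t : ℝ≥0∞) < exitTime U w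
          · rw [Set.indicator_of_mem (Set.mem_inter hwB h1),
              Set.indicator_of_mem (Set.mem_inter hwB (hiff.1 h1).1)]
            refine (Set.indicator_of_mem ?_ F).symm
            exact (hiff.1 h1).2
          · rw [Set.indicator_of_notMem fun h => h1 h.2]
            by_cases h2 : τ w < exitTime U w
            · rw [Set.indicator_of_mem (Set.mem_inter hwB h2)]
              refine (Set.indicator_of_notMem ?_ F).symm
              exact fun h => h1 (hiff.2 ⟨h2, h⟩)
            · rw [Set.indicator_of_notMem fun h => h2 h.2]
        · rw [Set.indicator_of_notMem fun h => hwB h.1, Set.indicator_of_notMem fun h => hwB h.1]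
    _ = _ := by
        rw [key]
        refine lintegral_congr fun w => ?_
        rw [← lintegral_indicator (hD _)]
        rfl

lemma condLawT_of_pos (x : E d) {t : ℝ} (ht : 0 < t) :
    condLawT W U x t = (W x {w | (t.toNNReal : ℝ≥0∞) < exitTime U w})⁻¹ •
      (W x).restrict {w | (t.toNNReal : ℝ≥0∞) < exitTime U w} := by
  rw [condLawT, if_neg ht.not_ge]
  rfl

lemma IsWiener.measurable_setLIntegral_lt_exitTime (hW : IsWiener W) (hU : IsOpen U) (t : ℝ≥0)
    {F : ℝ≥0 × PathSpace d → ℝ≥0∞} (hF : Measurable F) :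
    Measurable fun p : ℝ≥0 × E d =>
      ∫⁻ w in {w | ((t - p.1 : ℝ≥0) : ℝ≥0∞) < exitTime U w}, F (p.1, w) ∂(W p.2) := by
  have hD (r : ℝ≥0) : MeasurableSet {w : PathSpace d | (r : ℝ≥0∞) < exitTime U w} :=
    measurableSet_lt measurable_const (measurable_exitTime hU)
  simp only [← lintegral_indicator (hD _)]
  exact hW.measurable_lintegral (hF.indicator (measurableSet_lt_exitTime_prod hU t))

/-- The strong Markov property on the event of survival up to time `t`, with the expectation
of the future path normalised by its probability of survival for the remaining time. -/
lemma IsWiener.setLIntegral_shift_eq_setLIntegral_average (hW : IsWiener W) (hU : IsOpen U)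
    {x : E d} (hx : x ∈ U)
    (hτ : ∀ s : ℝ≥0, MeasurableSet[natFiltration d s] {w | τ w < (s : ℝ≥0∞)})
    {A : Set (PathSpace d)}
    (hA : ∀ s : ℝ≥0, MeasurableSet[natFiltration d s] (A ∩ {w | τ w < (s : ℝ≥0∞)}))
    (t : ℝ≥0) {F : ℝ≥0 × PathSpace d → ℝ≥0∞} (hF : Measurable F) :
    ∫⁻ w in (A ∩ {w | τ w < (t : ℝ≥0∞)}) ∩ {w | (t : ℝ≥0∞) < exitTime U w},
        F ((τ w).toNNReal, shift (τ w).toNNReal w) ∂(W x)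
      = ∫⁻ w in (A ∩ {w | τ w < (t : ℝ≥0∞)}) ∩ {w | (t : ℝ≥0∞) < exitTime U w},
          (W (w (τ w).toNNReal) {w' | ((t - (τ w).toNNReal : ℝ≥0) : ℝ≥0∞) < exitTime U w'})⁻¹ *
          ∫⁻ w' in {w' | ((t - (τ w).toNNReal : ℝ≥0) : ℝ≥0∞) < exitTime U w'},
            F ((τ w).toNNReal, w') ∂(W (w (τ w).toNNReal)) ∂(W x) := by
  have := hW.isProbabilityMeasure
  let M (p : ℝ≥0 × E d) : ℝ≥0∞ := W p.2 {w | ((t - p.1 : ℝ≥0) : ℝ≥0∞) < exitTime U w}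
  let I (p : ℝ≥0 × E d) : ℝ≥0∞ :=
    ∫⁻ w in {w | ((t - p.1 : ℝ≥0) : ℝ≥0∞) < exitTime U w}, F (p.1, w) ∂(W p.2)
  have hM : Measurable M := by
    have h := hW.measurable_setLIntegral_lt_exitTime hU t (F := fun _ => 1) measurable_const
    simp only [setLIntegral_one] at h
    exact h
  have hI : Measurable I := hW.measurable_setLIntegral_lt_exitTime hU t hF
  have hMI (p : ℝ≥0 × E d) : M p * ((M p)⁻¹ * I p) = I p := by
    by_cases h0 : M p = 0
    · have : I p = 0 := by
        simp only [I, Measure.restrict_eq_zero.2 h0, lintegral_zero_measure]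
      rw [this, mul_zero, mul_zero]
    · rw [← mul_assoc, ENNReal.mul_inv_cancel h0 (measure_ne_top _ _), one_mul]
  let G (p : ℝ≥0 × PathSpace d) : ℝ≥0∞ := (M (p.1, p.2 0))⁻¹ * I (p.1, p.2 0)
  have h0 : Measurable fun p : ℝ≥0 × PathSpace d => (p.1, p.2 0) :=
    measurable_fst.prodMk ((measurable_pathSpace_eval 0).comp measurable_snd)
  have hG : Measurable G := (hM.comp h0).inv.mul (hI.comp h0)
  have hGint (r : ℝ≥0) (y : E d) :
      ∫⁻ w in {w | ((t - r : ℝ≥0) : ℝ≥0∞) < exitTime U w}, G (r, w) ∂(W y) = I (r, y) := by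
    have : ∀ᵐ w ∂(W y).restrict {w | ((t - r : ℝ≥0) : ℝ≥0∞) < exitTime U w},
        G (r, w) = (M (r, y))⁻¹ * I (r, y) := by
      filter_upwards [ae_restrict_of_ae (hW.ae_eval_zero y)] with w hw
      simp only [G, hw]
    rw [lintegral_congr_ae this, lintegral_const, Measure.restrict_apply_univ, mul_comm]
    exact hMI (r, y)
  have key := hW.setLIntegral_shift_lt_exitTime hU hx hτ hA t hG
  simp only [hGint] at key
  rw [hW.setLIntegral_shift_lt_exitTime hU hx hτ hA t hF]
  refine key.symm.trans (lintegral_congr fun w => ?_)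
  have hshift (r : ℝ≥0) : shift r w 0 = w r := congrArg w (add_zero r)
  simp only [G, M, I, hshift]

end Conditioned

/-- **Strong Markov property of the conditioned laws** (Proposition 2.1): for an optional
time `τ`, a set `A ∈ F_{τ+}` and a nonnegative measurable function `f(s, w)`,
`W̃^U_{x,t}(A; τ < t; f(τ, θ_τ ·)) = W̃^U_{x,t}(A; τ < t; W̃^U_{X_τ, t-τ}(f(τ, ·)))`. -/
theorem strong_markov_conditioned {d : ℕ}
    (W : E d → Measure (PathSpace d)) (hW : IsWiener W)
    (U : Set (E d)) (hU : IsOpen U) (x : E d) (hx : x ∈ U) (t : ℝ) (ht : 0 < t)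
    (hpos : 0 < W x {w | ENNReal.ofReal t < exitTime U w})
    (τ : PathSpace d → ℝ≥0∞)
    (hτ : ∀ s : ℝ≥0, MeasurableSet[natFiltration d s] {w | τ w < (s : ℝ≥0∞)})
    (A : Set (PathSpace d))
    (hA : ∀ s : ℝ≥0, MeasurableSet[natFiltration d s] (A ∩ {w | τ w < (s : ℝ≥0∞)}))
    (f : ℝ≥0 → PathSpace d → ℝ≥0∞) (hf : Measurable (Function.uncurry f)) :
    ∫⁻ w in A ∩ {w | τ w < ENNReal.ofReal t},
        f (τ w).toNNReal (shift (τ w).toNNReal w) ∂(condLawT W U x t)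
      = ∫⁻ w in A ∩ {w | τ w < ENNReal.ofReal t},
          (∫⁻ w', f (τ w).toNNReal w'
            ∂(condLawT W U (w (τ w).toNNReal) (t - ((τ w).toNNReal : ℝ))))
          ∂(condLawT W U x t) := by
  have hB : MeasurableSet (A ∩ {w | τ w < ENNReal.ofReal t}) :=
    natFiltration_le _ _ (hA t.toNNReal)
  rw [condLawT_of_pos x ht, setLIntegral_smul_measure, setLIntegral_smul_measure,
    Measure.restrict_restrict hB]
  congr 1
  refine (hW.setLIntegral_shift_eq_setLIntegral_average hU hx hτ hA t.toNNReal hf).trans ?_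
  have hD : MeasurableSet {w : PathSpace d | (t.toNNReal : ℝ≥0∞) < exitTime U w} :=
    measurableSet_lt measurable_const (measurable_exitTime hU)
  refine setLIntegral_congr_fun (hB.inter hD) fun w hw => ?_
  have hlt : τ w < ENNReal.ofReal t := hw.1.2
  have hr : (τ w).toNNReal < t.toNNReal := by
    rw [← ENNReal.coe_lt_coe, ENNReal.coe_toNNReal (lt_top_of_lt hlt).ne]
    exact hlt
  have hrt : 0 < t - (τ w).toNNReal := sub_pos.2 (Real.lt_toNNReal_iff_coe_lt.1 hr)
  have hsub : (t - (τ w).toNNReal).toNNReal = t.toNNReal - (τ w).toNNReal := by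
    rw [NNReal.sub_def, Real.coe_toNNReal t ht.le]
  simp only [condLawT_of_pos _ hrt, lintegral_smul_measure, hsub, smul_eq_mul]
  rfl

end
end

section
/- Let U ⊆ ℝ^d be an open co-regular set and x0 ∈ ∂U. Suppose that for every t ∈ (0,1) the first transition law W̃^U_{x,1}(X_t ∈ ·) converges weakly, as x ∈ U tends to x0, to a probability measure μ_t on ℝ^d with μ_t(∂U) = 0. Then all finite-dimensional distributions of W̃^U_{x,1} converge weakly as x ∈ U tends to x0: for every 0 < t_1 < t_2 < … < t_k ≤ 1 the joint law of (X_{t_1}, …, X_{t_k}) under W̃^U_{x,1} converges weakly to a probability measure on (ℝ^d)^k. -/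
open MeasureTheory ProbabilityTheory Filter Topology NNReal ENNReal

noncomputable section

/-- `U` is *co-regular* if Brownian motion started at any boundary point of `U` leaves the
closure of `U` instantaneously: `W_x(τ_{cl U} > 0) = 0` for every `x ∈ ∂U`. -/
def IsCoRegular {d : ℕ} (W : E d → Measure (PathSpace d)) (U : Set (E d)) : Prop :=
  ∀ x ∈ frontier U, W x {w | 0 < exitTime (closure U) w} = 0

theorem pathSpace_measurableSpace_eq (d : ℕ) :
    borel (PathSpace d) =
      MeasurableSpace.comap (fun (w : PathSpace d) (r : ℝ≥0) => w r) MeasurableSpace.pi := by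
  have key : ∀ r : ℝ≥0, Measurable[MeasurableSpace.comap
      (fun (w : PathSpace d) (r : ℝ≥0) => w r) MeasurableSpace.pi] fun w : PathSpace d => w r :=
    fun r => (measurable_pi_apply r).comp (comap_measurable _)
  apply le_antisymm
  · rw [borel_eq_generateFrom_of_subbasis (ContinuousMap.compactOpen_eq)]
    refine MeasurableSpace.generateFrom_le ?_
    rintro s ⟨K, hK, V, hV, hs⟩
    obtain ⟨D, hDK, hDc, hD⟩ := TopologicalSpace.IsSeparable.of_separableSpace K
      |>.exists_countable_dense_subset
    have hset : s =
        ⋃ n : ℕ, ⋂ q ∈ D, (fun w : PathSpace d => w q) ⁻¹'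
          {y | ((n : ℝ≥0∞) + 1)⁻¹ ≤ Metric.infEDist y Vᶜ} := by
      rw [← hs]
      ext f
      simp only [Set.mem_ofPred_eq, Set.mem_iUnion, Set.mem_iInter, Set.mem_preimage]
      constructor
      · intro hf
        have hc : IsCompact (f '' K) := hK.image f.continuous
        obtain ⟨δ, hδ, h⟩ := hc.exists_thickening_subset_open hV
          (Set.mapsTo_iff_image_subset.mp hf)
        obtain ⟨n, hn⟩ := ENNReal.exists_inv_nat_lt (a := ENNReal.ofReal δ) (by simpa using hδ)
        refine ⟨n, fun q hq => ?_⟩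
        have h1 : ENNReal.ofReal δ ≤ Metric.infEDist (f q) Vᶜ := by
          refine Metric.le_infEDist.2 fun z hz => ?_
          by_contra hlt
          push Not at hlt
          apply hz
          apply h
          rw [Metric.mem_thickening_iff_exists_edist_lt]
          exact ⟨f q, ⟨q, hDK hq, rfl⟩, by rwa [edist_comm]⟩
        refine le_trans ?_ (hn.le.trans h1)
        exact ENNReal.inv_le_inv.2 le_self_add
      · rintro ⟨n, hn⟩ r hr
        have hcl : IsClosed {r : ℝ≥0 | ((n : ℝ≥0∞) + 1)⁻¹ ≤ Metric.infEDist (f r) Vᶜ} :=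
          isClosed_le continuous_const (Metric.continuous_infEDist.comp f.continuous)
        have h2 : ((n : ℝ≥0∞) + 1)⁻¹ ≤ Metric.infEDist (f r) Vᶜ :=
          closure_minimal (s := D) (fun q hq => hn q hq) hcl (hD hr)
        by_contra hV'
        have : Metric.infEDist (f r) Vᶜ = 0 := Metric.infEDist_zero_of_mem hV'
        simp [this] at h2
    rw [hset]
    refine @MeasurableSet.iUnion _ _ (_) _ _ fun n =>
      @MeasurableSet.biInter _ _ (_) _ _ hDc fun q _ => ?_
    exact key q (measurableSet_le measurable_const measurable_infEDist)
  · rw [← measurable_iff_comap_le]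
    exact measurable_pi_lambda _ fun r => (continuous_eval_const r).measurable

theorem measurable_path_eval {d : ℕ} (r : ℝ≥0) : Measurable fun w : PathSpace d => w r :=
  (continuous_eval_const r).measurable

theorem measurable_path {d : ℕ} {α : Type*} [MeasurableSpace α] {f : α → PathSpace d}
    (hf : ∀ r, Measurable fun a => f a r) : Measurable f := by
  have h : Measurable[_, MeasurableSpace.comap
      (fun (w : PathSpace d) (r : ℝ≥0) => w r) MeasurableSpace.pi] f := by
    rw [measurable_comap_iff]
    exact measurable_pi_lambda _ hf
  rw [← pathSpace_measurableSpace_eq] at h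
  exact h

theorem pathSpace_measure_ext {d : ℕ} {μ ν : Measure (PathSpace d)} [IsFiniteMeasure μ]
    [IsFiniteMeasure ν]
    (h : ∀ I : Finset ℝ≥0, μ.map (fun w (i : I) => w i) = ν.map (fun w (i : I) => w i)) :
    μ = ν := by
  have hm : Measurable fun (w : PathSpace d) (r : ℝ≥0) => w r :=
    measurable_pi_lambda _ measurable_path_eval
  have h1 : μ.map (fun (w : PathSpace d) (r : ℝ≥0) => w r) = ν.map (fun w r => w r) := by
    refine IsProjectiveLimit.unique (P := fun I : Finset ℝ≥0 => μ.map (fun w (i : I) => w i))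
      (fun I => ?_) (fun I => ?_)
    · rw [Measure.map_map (by fun_prop) hm]; rfl
    · rw [Measure.map_map (by fun_prop) hm]; exact (h I).symm
  ext s hs
  have hs' : MeasurableSet[borel _] s := hs
  rw [pathSpace_measurableSpace_eq] at hs'
  obtain ⟨t, ht, rfl⟩ := hs'
  rw [← Measure.map_apply hm ht, h1, Measure.map_apply hm ht]

/-- `ν` is the law of Brownian motion started at `x`. -/
def IsBrownianLaw {d : ℕ} (x : E d) (ν : Measure (PathSpace d)) : Prop :=
  IsProbabilityMeasure ν ∧ ν {w | w 0 = x} = 1 ∧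
    ∀ (n : ℕ) (t : Fin (n + 1) → ℝ≥0), Monotone t →
      ν.map (fun w (p : Fin n × Fin d) => w (t p.1.succ) p.2 - w (t p.1.castSucc) p.2)
        = Measure.pi (fun p : Fin n × Fin d => gaussianReal 0 (t p.1.succ - t p.1.castSucc))

theorem measurableSet_start {d : ℕ} (x : E d) : MeasurableSet {w : PathSpace d | w 0 = x} :=
  measurable_path_eval 0 (measurableSet_singleton x)

theorem IsBrownianLaw.ae_start {d : ℕ} {x : E d} {ν : Measure (PathSpace d)}
    (h : IsBrownianLaw x ν) : ∀ᵐ w ∂ν, w 0 = x := by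
  have := h.1
  exact (prob_compl_eq_zero_iff (measurableSet_start x)).2 h.2.1

theorem measurable_increments_s3 {d n : ℕ} (t : Fin (n + 1) → ℝ≥0) :
    Measurable fun (w : PathSpace d) (p : Fin n × Fin d) =>
      w (t p.1.succ) p.2 - w (t p.1.castSucc) p.2 := by
  refine measurable_pi_lambda _ fun p => ?_
  have h (r : ℝ≥0) (j : Fin d) : Measurable fun w : PathSpace d => w r j :=
    (EuclideanSpace.proj (𝕜 := ℝ) j).continuous.measurable.comp (measurable_path_eval r)
  exact (h _ _).sub (h _ _)

theorem IsBrownianLaw.unique {d : ℕ} {x : E d} {μ ν : Measure (PathSpace d)}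
    (hμ : IsBrownianLaw x μ) (hν : IsBrownianLaw x ν) : μ = ν := by
  have := hμ.1
  have := hν.1
  refine pathSpace_measure_ext fun I => ?_
  let e := I.orderIsoOfFin rfl
  let t : Fin (I.card + 1) → ℝ≥0 := Fin.cons 0 fun i => (e i : ℝ≥0)
  have ht : Monotone t := by
    refine Fin.monotone_iff_le_succ.2 fun i => ?_
    rcases Fin.eq_zero_or_eq_succ i.castSucc with h0 | ⟨j, hj⟩
    · rw [h0]; exact zero_le
    · rw [hj]
      have : j ≤ i := by
        rw [← Fin.succ_le_succ_iff, ← hj]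
        exact Fin.castSucc_le_succ i
      exact e.monotone this
  have hrec : ∀ m : Fin (I.card + 1), ∃ R : (Fin I.card × Fin d → ℝ) → E d, Measurable R ∧
      ∀ w : PathSpace d, w (t m) = w 0 +
        R (fun p => w (t p.1.succ) p.2 - w (t p.1.castSucc) p.2) := by
    intro m
    induction m using Fin.induction with
    | zero => exact ⟨fun _ => 0, measurable_const, fun w => (add_zero _).symm⟩
    | succ i ih =>
      obtain ⟨R, hR, h⟩ := ih
      refine ⟨fun z => R z + WithLp.toLp 2 fun c => z (i, c), hR.add ?_, fun w => ?_⟩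
      · exact (WithLp.measurable_toLp 2 _).comp (by fun_prop)
      · rw [← add_assoc, ← h w]
        ext c
        simp
  choose R hR hRw using hrec
  have hmap : ∀ ρ : Measure (PathSpace d), IsBrownianLaw x ρ →
      ρ.map (fun w (i : I) => w i) =
        (ρ.map fun w (p : Fin I.card × Fin d) =>
          w (t p.1.succ) p.2 - w (t p.1.castSucc) p.2).map
          fun z (i : I) => x + R (e.symm i).succ z := by
    intro ρ hρ
    rw [Measure.map_map (measurable_pi_lambda _ fun i => (hR _).const_add x)
      (measurable_increments_s3 t)]
    refine Measure.map_congr ?_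
    filter_upwards [hρ.ae_start] with w hw
    funext i
    have := hRw (e.symm i).succ w
    have hti : t (e.symm i).succ = i := by simp [t]
    rw [hti, hw] at this
    exact this
  rw [hmap μ hμ, hmap ν hν, hμ.2.2 _ t ht, hν.2.2 _ t ht]
theorem pi_gaussianReal_linear_combination {ι : Type*} [Fintype ι] (a b c : ι → ℝ≥0) (α β : ℝ)
    (hc : ∀ i, (c i : ℝ) = α ^ 2 * a i + β ^ 2 * b i) :
    ((Measure.pi fun i => gaussianReal 0 (a i)).prod
      (Measure.pi fun i => gaussianReal 0 (b i))).map (fun z i => α * z.1 i + β * z.2 i) =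
      Measure.pi fun i => gaussianReal 0 (c i) := by
  rw [← (measurePreserving_arrowProdEquivProdArrow ℝ ℝ ι (fun i => gaussianReal 0 (a i))
    (fun i => gaussianReal 0 (b i))).map_eq, Measure.map_map (by fun_prop)
    (MeasurableEquiv.measurable _)]
  have hi : ∀ i, ((gaussianReal 0 (a i)).prod (gaussianReal 0 (b i))).map
      (fun z => α * z.1 + β * z.2) = gaussianReal 0 (c i) := by
    intro i
    have h1 : (fun z : ℝ × ℝ => α * z.1 + β * z.2) =
      (fun z : ℝ × ℝ => z.1 + z.2) ∘ (Prod.map (α * ·) (β * ·)) := rfl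
    rw [h1, ← Measure.map_map (by fun_prop) (by fun_prop),
      ← Measure.map_prod_map _ _ (by fun_prop) (by fun_prop), gaussianReal_map_const_mul,
      gaussianReal_map_const_mul]
    change Measure.conv _ _ = _
    rw [gaussianReal_conv_gaussianReal]
    congr 1
    · simp
    · ext
      simp [hc i]
  have h2 := Measure.pi_map_pi (μ := fun i => (gaussianReal 0 (a i)).prod (gaussianReal 0 (b i)))
    (f := fun _ z => α * z.1 + β * z.2)
    (hμ := fun i => by rw [hi i]; infer_instance) (fun i => by fun_prop)
  simp_rw [hi] at h2
  exact h2

theorem IsBrownianLaw.combine {d : ℕ} {x y z : E d} {μ ν : Measure (PathSpace d)}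
    (hμ : IsBrownianLaw x μ) (hν : IsBrownianLaw y ν) {F : PathSpace d × PathSpace d → PathSpace d}
    (hF : Measurable F) (α β : ℝ) {τ σ : ℝ≥0 → ℝ≥0} (hτ : Monotone τ) (hσ : Monotone σ)
    (hstart : ∀ u v, u 0 = x → v 0 = y → F (u, v) 0 = z)
    (hinc : ∀ u v r r', F (u, v) r' - F (u, v) r =
      α • (u (τ r') - u (τ r)) + β • (v (σ r') - v (σ r)))
    (hvar : ∀ r r', r ≤ r' → ((r' - r : ℝ≥0) : ℝ) =
      α ^ 2 * (τ r' - τ r : ℝ≥0) + β ^ 2 * (σ r' - σ r : ℝ≥0)) :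
    IsBrownianLaw z ((μ.prod ν).map F) := by
  have := hμ.1
  have := hν.1
  have hprob : IsProbabilityMeasure ((μ.prod ν).map F) :=
    Measure.isProbabilityMeasure_map hF.aemeasurable
  refine ⟨hprob, ?_, fun n t ht => ?_⟩
  · rw [← prob_compl_eq_zero_iff (measurableSet_start z)]
    change ∀ᵐ w ∂((μ.prod ν).map F), w 0 = z
    rw [ae_map_iff hF.aemeasurable (measurableSet_start z)]
    filter_upwards [Measure.quasiMeasurePreserving_fst.ae hμ.ae_start,
      Measure.quasiMeasurePreserving_snd.ae hν.ae_start] with p h1 h2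
    exact hstart p.1 p.2 h1 h2
  · have hμt := hμ.2.2 n (τ ∘ t) (hτ.comp ht)
    have hνt := hν.2.2 n (σ ∘ t) (hσ.comp ht)
    have hmτ := measurable_increments_s3 (d := d) (τ ∘ t)
    have hmσ := measurable_increments_s3 (d := d) (σ ∘ t)
    simp only [Function.comp_apply] at hμt hνt hmτ hmσ
    rw [← pi_gaussianReal_linear_combination
      (fun p : Fin n × Fin d => τ (t p.1.succ) - τ (t p.1.castSucc))
      (fun p : Fin n × Fin d => σ (t p.1.succ) - σ (t p.1.castSucc)) _ α β
      (fun p => hvar _ _ (ht (Fin.castSucc_le_succ _))),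
      ← hμt, ← hνt,
      Measure.map_prod_map _ _ hmτ hmσ,
      Measure.map_map (measurable_increments_s3 _) hF,
      Measure.map_map (by fun_prop) (hmτ.prodMap hmσ)]
    congr 1
    funext q p
    have := congrArg (fun e : E d => e p.2) (hinc q.1 q.2 (t p.1.castSucc) (t p.1.succ))
    simpa using this

/-- The path that follows `u` up to time `s` and the increments of `v` afterwards. -/
def gluePath {d : ℕ} (s : ℝ≥0) (p : PathSpace d × PathSpace d) : PathSpace d where
  toFun r := p.1 (min r s) + (p.2 (r - s) - p.2 0)

theorem gluePath_apply {d : ℕ} (s : ℝ≥0) (p : PathSpace d × PathSpace d) (r : ℝ≥0) :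
    gluePath s p r = p.1 (min r s) + (p.2 (r - s) - p.2 0) := rfl

theorem gluePath_of_le {d : ℕ} {s r : ℝ≥0} (h : r ≤ s) (p : PathSpace d × PathSpace d) :
    gluePath s p r = p.1 r := by
  simp [gluePath_apply, h, tsub_eq_zero_of_le h]

theorem measurable_gluePath {d : ℕ} (s : ℝ≥0) :
    Measurable (gluePath s : PathSpace d × PathSpace d → PathSpace d) :=
  measurable_path fun _ => ((measurable_path_eval _).comp measurable_fst).add
    (((measurable_path_eval _).comp measurable_snd).sub
      ((measurable_path_eval _).comp measurable_snd))

/-- The simple Markov property at the deterministic time `s`. -/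
theorem IsBrownianLaw.map_gluePath {d : ℕ} {x y : E d} {μ ν : Measure (PathSpace d)}
    (hμ : IsBrownianLaw x μ) (hν : IsBrownianLaw y ν) (s : ℝ≥0) :
    (μ.prod ν).map (gluePath s) = μ := by
  refine IsBrownianLaw.unique (hμ.combine hν (measurable_gluePath s) 1 1
    (τ := fun r => min r s) (σ := fun r => r - s) (fun a b h => min_le_min_right s h)
    (fun a b h => tsub_le_tsub_right h s) (fun u v hu _ => ?_) (fun u v r r' => ?_)
    fun r r' h => ?_) hμ
  · rw [gluePath_of_le zero_le, hu]
  · simp only [gluePath_apply, one_smul]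
    abel
  · have h1 := min_le_min_right s h
    have h2 := tsub_le_tsub_right h s
    rw [NNReal.coe_sub h, NNReal.coe_sub h1, NNReal.coe_sub h2, NNReal.coe_min, NNReal.coe_min,
      NNReal.coe_sub_def, NNReal.coe_sub_def]
    rcases le_total (r : ℝ) s with h3 | h3 <;> rcases le_total (r' : ℝ) s with h4 | h4 <;>
    simp [h3, h4]

/-- Translation of a path by a constant vector. -/
def shiftPath {d : ℕ} (y : E d) (v : PathSpace d) : PathSpace d := ContinuousMap.const _ y + v

theorem shiftPath_apply {d : ℕ} (y : E d) (v : PathSpace d) (r : ℝ≥0) :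
    shiftPath y v r = y + v r := rfl

theorem measurable_shiftPath {d : ℕ} :
    Measurable fun p : E d × PathSpace d => shiftPath p.1 p.2 :=
  measurable_path fun _ => measurable_fst.add ((measurable_path_eval _).comp measurable_snd)

theorem measurable_shiftPath_right {d : ℕ} (y : E d) : Measurable (shiftPath y) :=
  measurable_shiftPath.comp (measurable_const.prodMk measurable_id)

theorem IsBrownianLaw.map_shiftPath {d : ℕ} {x : E d} {μ ν : Measure (PathSpace d)}
    (hμ : IsBrownianLaw 0 μ) (hν : IsBrownianLaw x ν) : μ.map (shiftPath x) = ν := by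
  have := hμ.1
  have hm : Measurable fun p : PathSpace d × PathSpace d => shiftPath x p.2 :=
    (measurable_shiftPath_right x).comp measurable_snd
  have h := IsBrownianLaw.unique (hμ.combine hμ hm 0 1 (τ := id) (σ := id) monotone_id monotone_id
    (z := x) (fun u v _ hv => by simp [shiftPath_apply, hv])
    (fun _ _ _ _ => by simp [shiftPath_apply]) (by simp)) hν
  rw [← h]
  have h2 : (fun p : PathSpace d × PathSpace d => shiftPath x p.2) = shiftPath x ∘ Prod.snd := rfl
  rw [h2, ← Measure.map_map (measurable_shiftPath_right x) measurable_snd, Measure.map_snd_prod]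
  simp

theorem measure_forall_norm_lt_pos {d : ℕ} {μ : Measure (PathSpace d)} (hμ : IsBrownianLaw 0 μ)
    (T : ℝ≥0) {ρ : ℝ} (hρ : 0 < ρ) : 0 < μ {w | ∀ r ≤ T, ‖w r‖ < ρ} := by
  have := hμ.1
  obtain ⟨φ, -, hφ⟩ := exists_mem_forall_mem_nhdsWithin_pos_measure (μ := μ) (s := Set.univ)
    (by simp)
  simp only [nhdsWithin_univ] at hφ
  let N : Set (PathSpace d) := {w | ∀ r ∈ Set.Icc 0 T, dist (w r) (φ r) < ρ / 2}
  have hN : N ∈ 𝓝 φ := by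
    have h := (ContinuousMap.tendsto_iff_forall_isCompact_tendstoUniformlyOn
      (f := φ) (p := 𝓝 φ) (F := fun w => w)).1 tendsto_id (Set.Icc 0 T) isCompact_Icc
    rw [Metric.tendstoUniformlyOn_iff] at h
    filter_upwards [h (ρ / 2) (by positivity)] with w hw r hr
    rw [dist_comm]
    exact hw r hr
  have hs : (Real.sqrt 2)⁻¹ ^ 2 = 1 / 2 := by simp
  let F : PathSpace d × PathSpace d → PathSpace d := fun p =>
    (Real.sqrt 2)⁻¹ • p.1 + (-(Real.sqrt 2)⁻¹) • p.2
  have hF : Measurable F := measurable_path fun r =>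
    (((measurable_path_eval r).comp measurable_fst).const_smul _).add
      (((measurable_path_eval r).comp measurable_snd).const_smul _)
  have h := IsBrownianLaw.unique (hμ.combine hμ hF (Real.sqrt 2)⁻¹ (-(Real.sqrt 2)⁻¹)
    (τ := id) (σ := id) monotone_id monotone_id (z := 0) (fun u v hu hv => by simp [F, hu, hv])
    (fun u v r r' => by simp [F, smul_sub]; abel)
    (fun r r' _ => by rw [neg_sq, hs]; simp only [id]; ring)) hμ
  have hpos : 0 < (μ.prod μ) (N ×ˢ N) := by
    rw [Measure.prod_prod]
    exact ENNReal.mul_pos (hφ N hN).ne' (hφ N hN).ne'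
  refine hpos.trans_le (le_trans ?_ ((Measure.le_map_apply hF.aemeasurable _).trans
    (congrArg (· {w : PathSpace d | ∀ r ≤ T, ‖w r‖ < ρ}) (congrArg DFunLike.coe h)).le))
  refine measure_mono ?_
  rintro ⟨u, v⟩ ⟨hu, hv⟩ r hr
  have h1 := hu r ⟨zero_le, hr⟩
  have h2 := hv r ⟨zero_le, hr⟩
  have h3 : F (u, v) r = (Real.sqrt 2)⁻¹ • (u r - v r) := by
    simp [F, smul_sub]; abel
  rw [h3, norm_smul, ← dist_eq_norm]
  have h4 : dist (u r) (v r) < ρ := by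
    have := dist_triangle_right (u r) (v r) (φ r)
    linarith
  have h5 : ‖(Real.sqrt 2)⁻¹‖ ≤ 1 := by
    rw [norm_inv, Real.norm_of_nonneg (Real.sqrt_nonneg _)]
    exact inv_le_one_of_one_le₀ (Real.one_le_sqrt.2 one_le_two)
  nlinarith [dist_nonneg (x := u r) (y := v r), norm_nonneg (Real.sqrt 2)⁻¹]

/-- The paths that stay in `A` during the time interval `(0, T]`. -/
def stayIn {d : ℕ} (A : Set (E d)) (T : ℝ≥0) : Set (PathSpace d) :=
  {w | ∀ r, 0 < r → r ≤ T → w r ∈ A}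

theorem isClosed_stayIn {d : ℕ} {A : Set (E d)} (hA : IsClosed A) (T : ℝ≥0) :
    IsClosed (stayIn A T) := by
  have : stayIn A T = ⋂ r : ℝ≥0, ⋂ _ : 0 < r, ⋂ _ : r ≤ T, (fun w : PathSpace d => w r) ⁻¹' A := by
    ext w; simp [stayIn]
  rw [this]
  exact isClosed_iInter fun r => isClosed_iInter fun _ => isClosed_iInter fun _ =>
    hA.preimage (continuous_eval_const r)

theorem measurableSet_stayIn {d : ℕ} {A : Set (E d)} (hA : IsOpen A) (T : ℝ≥0) :
    MeasurableSet (stayIn A T) := by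
  have : stayIn A T =
      ⋂ n : ℕ, {w : PathSpace d | Set.MapsTo w (Set.Icc ((n : ℝ≥0) + 1)⁻¹ T) A} := by
    ext w
    simp only [stayIn, Set.mem_ofPred_eq, Set.mem_iInter]
    constructor
    · intro h n r hr
      exact h r (lt_of_lt_of_le (by positivity) hr.1) hr.2
    · intro h r h0 hr
      obtain ⟨n, hn⟩ := exists_nat_one_div_lt (K := ℝ) h0
      refine h n ⟨?_, hr⟩
      rw [← NNReal.coe_le_coe]
      simpa using hn.le
  rw [this]
  exact MeasurableSet.iInter fun n =>
    (ContinuousMap.isOpen_setOfPred_mapsTo isCompact_Icc hA).measurableSet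

theorem setOf_one_lt_exitTime {d : ℕ} {U : Set (E d)} (hU : IsOpen U) :
    {w : PathSpace d | 1 < exitTime U w} = stayIn U 1 := by
  ext w
  simp only [stayIn, Set.mem_ofPred_eq]
  constructor
  · intro h r h0 hr
    by_contra hw
    have h1 : exitTime U w ≤ r := sInf_le ⟨r, ⟨h0, hw⟩, rfl⟩
    exact absurd (h.trans_le h1) (not_lt.2 (by exact_mod_cast hr))
  · intro h
    have h1 : ∀ᶠ r in 𝓝 (1 : ℝ≥0), w r ∈ U :=
      w.continuous.continuousAt.eventually (hU.mem_nhds (h 1 one_pos le_rfl))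
    obtain ⟨b, hb, hb'⟩ := exists_Ico_subset_of_mem_nhds h1 ⟨2, one_lt_two⟩
    refine lt_of_lt_of_le (b := (b : ℝ≥0∞)) (by exact_mod_cast hb) (le_sInf ?_)
    rintro _ ⟨r, ⟨h0, hr⟩, rfl⟩
    rw [ENNReal.coe_le_coe]
    by_contra hlt
    push Not at hlt
    rcases le_total r 1 with h2 | h2
    · exact hr (h r h0 h2)
    · exact hr (hb' ⟨h2, hlt⟩)

theorem stayIn_subset_exitTime_pos {d : ℕ} (A : Set (E d)) {T : ℝ≥0} (hT : 0 < T) :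
    stayIn A T ⊆ {w | 0 < exitTime A w} := by
  intro w hw
  refine lt_of_lt_of_le (b := (T : ℝ≥0∞)) (by exact_mod_cast hT) (le_sInf ?_)
  rintro _ ⟨r, ⟨h0, hr⟩, rfl⟩
  rw [ENNReal.coe_le_coe]
  by_contra hlt
  exact hr (hw r h0 (not_le.1 hlt).le)

/-- The part of the path `w` after time `s`. -/
def delayPath {d : ℕ} (s : ℝ≥0) (w : PathSpace d) : PathSpace d := ⟨fun r => w (s + r), by fun_prop⟩

theorem delayPath_apply {d : ℕ} (s : ℝ≥0) (w : PathSpace d) (r : ℝ≥0) :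
    delayPath s w r = w (s + r) := rfl

theorem measurable_delayPath {d : ℕ} (s : ℝ≥0) :
    Measurable (delayPath s : PathSpace d → PathSpace d) :=
  measurable_path fun _ => measurable_path_eval _

theorem delayPath_gluePath {d : ℕ} (s : ℝ≥0) (u : PathSpace d) {v : PathSpace d} (hv : v 0 = 0) :
    delayPath s (gluePath s (u, v)) = shiftPath (u s) v := by
  ext1 r
  simp [delayPath_apply, gluePath_apply, shiftPath_apply, hv]

theorem measurable_shiftPath_eval {d : ℕ} (s : ℝ≥0) :
    Measurable fun p : PathSpace d × PathSpace d => shiftPath (p.1 s) p.2 :=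
  measurable_shiftPath.comp (((measurable_path_eval s).comp measurable_fst).prodMk measurable_snd)

/-- The simple Markov property on an event `A` determined by the path up to time `s`. -/
theorem IsBrownianLaw.map_delayPath {d : ℕ} {x : E d} {μ P : Measure (PathSpace d)}
    (hμ : IsBrownianLaw x μ) (hP : IsBrownianLaw 0 P) {s : ℝ≥0} {A : Set (PathSpace d)}
    (hA : MeasurableSet A) (hAs : ∀ u v, (∀ r ≤ s, u r = v r) → u ∈ A → v ∈ A) :
    (μ.restrict A).map (delayPath s) =
      ((μ.restrict A).prod P).map fun p => shiftPath (p.1 s) p.2 := by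
  have := hμ.1
  have := hP.1
  ext B hB
  rw [Measure.map_apply (measurable_delayPath s) hB,
    Measure.map_apply (measurable_shiftPath_eval s) hB,
    Measure.restrict_apply (measurable_delayPath s hB)]
  conv_lhs => rw [← hμ.map_gluePath hP s]
  rw [Measure.map_apply (measurable_gluePath s) ((measurable_delayPath s hB).inter hA)]
  have h : (μ.restrict A).prod P = (μ.prod P).restrict (A ×ˢ Set.univ) := by
    rw [← Measure.prod_restrict, Measure.restrict_univ]
  rw [h, Measure.restrict_apply (measurable_shiftPath_eval s hB)]
  refine measure_congr ?_
  filter_upwards [Measure.quasiMeasurePreserving_snd.ae hP.ae_start] with p hp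
  have h1 : gluePath s p ∈ A ↔ p.1 ∈ A :=
    ⟨hAs _ _ fun r hr => gluePath_of_le hr p, hAs _ _ fun r hr => (gluePath_of_le hr p).symm⟩
  have h2 := delayPath_gluePath s p.1 hp
  refine propext ?_
  change delayPath s (gluePath s p) ∈ B ∧ gluePath s p ∈ A ↔
    shiftPath (p.1 s) p.2 ∈ B ∧ p.1 ∈ A ∧ p.2 ∈ Set.univ
  rw [h1, ← h2]
  simp

theorem IsBrownianLaw.measure_inter_delayPath {d : ℕ} {x : E d} {μ P : Measure (PathSpace d)}
    (hμ : IsBrownianLaw x μ) (hP : IsBrownianLaw 0 P) {s : ℝ≥0} {A : Set (PathSpace d)}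
    (hA : MeasurableSet A) (hAs : ∀ u v, (∀ r ≤ s, u r = v r) → u ∈ A → v ∈ A)
    {B : Set (PathSpace d)} (hB : MeasurableSet B) :
    μ (delayPath s ⁻¹' B ∩ A) = ∫⁻ u in A, P (shiftPath (u s) ⁻¹' B) ∂μ := by
  have := hμ.1
  have := hP.1
  have h := congrArg (· B) (hμ.map_delayPath hP hA hAs)
  rw [Measure.map_apply (measurable_delayPath s) hB,
    Measure.map_apply (measurable_shiftPath_eval s) hB,
    Measure.restrict_apply (measurable_delayPath s hB),
    Measure.prod_apply (measurable_shiftPath_eval s hB)] at h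
  exact h

theorem isOpen_setOf_measure_shiftPath_lt {d : ℕ} {P : Measure (PathSpace d)}
    [IsProbabilityMeasure P] {S : Set (PathSpace d)} (hS : IsClosed S) (η : ℝ≥0∞) :
    IsOpen {z : E d | P (shiftPath z ⁻¹' S) < η} := by
  rw [← isClosed_compl_iff]
  refine IsSeqClosed.isClosed fun z z₀ hz hlim => ?_
  simp only [Set.mem_compl_iff, Set.mem_ofPred_eq, not_lt] at hz ⊢
  have hm : ∀ y : E d, MeasurableSet (shiftPath y ⁻¹' S) := fun y =>
    measurable_shiftPath_right y hS.measurableSet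
  let V : ℕ → Set (PathSpace d) := fun n => ⋃ k : ℕ, shiftPath (z (n + k)) ⁻¹' S
  have hV : Antitone V := by
    refine antitone_nat_of_succ_le fun n => Set.iUnion_subset fun k => ?_
    refine Set.subset_iUnion_of_subset (k + 1) ?_
    rw [show n + (k + 1) = n + 1 + k by ring]
  have hlimV := tendsto_measure_iInter_atTop (μ := P)
    (fun n => (MeasurableSet.iUnion fun k => hm _).nullMeasurableSet) hV ⟨0, measure_ne_top _ _⟩
  have hη : η ≤ P (⋂ n, V n) := by
    refine ge_of_tendsto' hlimV fun n => (hz n).trans (measure_mono ?_)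
    exact Set.subset_iUnion_of_subset 0 (by simp)
  refine hη.trans (measure_mono fun v hv => ?_)
  have hcont : Continuous fun y : E d => shiftPath y v := by
    refine ContinuousMap.continuous_of_continuous_uncurry _ ?_
    exact continuous_fst.add (v.continuous.comp continuous_snd)
  by_contra hv'
  have h1 : ∀ᶠ n in atTop, shiftPath (z n) v ∈ Sᶜ :=
    ((hcont.tendsto z₀).comp hlim).eventually (hS.isOpen_compl.mem_nhds hv')
  obtain ⟨N, hN⟩ := eventually_atTop.1 h1
  obtain ⟨k, hk⟩ := Set.mem_iUnion.1 (Set.mem_iInter.1 hv N)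
  exact hN (N + k) (Nat.le_add_right _ _) hk

theorem IsBrownianLaw.measure_exists_mem_finset_le {d : ℕ} {x : E d} {μ P : Measure (PathSpace d)}
    (hμ : IsBrownianLaw x μ) (hP : IsBrownianLaw 0 P) {C O : Set (E d)} (hC : IsClosed C)
    (hO : MeasurableSet O) {ε T : ℝ≥0} {η : ℝ≥0∞}
    (hη : ∀ z ∈ O, P (shiftPath z ⁻¹' stayIn C ε) ≤ η) (F : Finset ℝ≥0)
    (hF : ∀ r ∈ F, r + ε ≤ T) :
    μ ({w | ∃ r ∈ F, w r ∈ O} ∩ stayIn C T) ≤ η * μ {w | ∃ r ∈ F, w r ∈ O} := by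
  induction F using Finset.induction_on_max with
  | empty => simp
  | insert m F hm ih =>
    have hmeas : ∀ G : Finset ℝ≥0, MeasurableSet {w : PathSpace d | ∃ r ∈ G, w r ∈ O} := by
      intro G
      have : {w : PathSpace d | ∃ r ∈ G, w r ∈ O} =
          ⋃ r ∈ G, (fun w : PathSpace d => w r) ⁻¹' O := by
        ext w; simp
      rw [this]
      exact G.measurableSet_biUnion fun r _ => measurable_path_eval r hO
    let A : Set (PathSpace d) := {w | ∃ r ∈ F, w r ∈ O}ᶜ ∩ {w | w m ∈ O}
    have hA : MeasurableSet A := (hmeas F).compl.inter (measurable_path_eval m hO)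
    have hAs : ∀ u v : PathSpace d, (∀ r ≤ m, u r = v r) → u ∈ A → v ∈ A := by
      rintro u v huv ⟨h1, h2⟩
      refine ⟨?_, ?_⟩
      · rintro ⟨r, hr, hvr⟩
        exact h1 ⟨r, hr, by rwa [huv r (hm r hr).le]⟩
      · change v m ∈ O
        rw [← huv m le_rfl]
        exact h2
    have hB : MeasurableSet (stayIn C ε) := (isClosed_stayIn hC ε).measurableSet
    have h1 : μ (delayPath m ⁻¹' stayIn C ε ∩ A) ≤ η * μ A := by
      rw [hμ.measure_inter_delayPath hP hA hAs hB, ← setLIntegral_const]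
      exact setLIntegral_mono' hA fun u hu => hη _ hu.2
    have h2 : {w : PathSpace d | ∃ r ∈ insert m F, w r ∈ O} = {w | ∃ r ∈ F, w r ∈ O} ∪ A := by
      ext w
      simp only [Finset.mem_insert, A, Set.mem_union, Set.mem_inter_iff, Set.mem_compl_iff,
        Set.mem_ofPred_eq, exists_eq_or_imp]
      by_cases h : ∃ a ∈ F, w a ∈ O <;> simp [h]
    have h3 : Disjoint {w : PathSpace d | ∃ r ∈ F, w r ∈ O} A :=
      Set.disjoint_left.2 fun w hw hw' => hw'.1 hw
    rw [h2, measure_union h3 hA, mul_add]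
    refine le_trans (measure_mono ?_) ((measure_union_le _ _).trans
      (add_le_add (ih fun r hr => hF r (Finset.mem_insert_of_mem hr)) h1))
    rintro w ⟨hw | hw, hwT⟩
    · exact Or.inl ⟨hw, hwT⟩
    · refine Or.inr ⟨fun r h0 hr => hwT _ (by positivity) ?_, hw⟩
      exact (add_le_add_right hr m).trans (hF m (Finset.mem_insert_self m F))

/-- A Brownian path which touches `F` before time `T` almost surely leaves `C` before time `T`, when
Brownian motion started on `F` leaves `C` instantaneously. -/
theorem IsBrownianLaw.measure_touch_inter_stayIn {d : ℕ} {x : E d} {μ P : Measure (PathSpace d)}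
    (hμ : IsBrownianLaw x μ) (hP : IsBrownianLaw 0 P) {C F : Set (E d)} (hC : IsClosed C)
    (hF : ∀ z ∈ F, ∀ ε, 0 < ε → P (shiftPath z ⁻¹' stayIn C ε) = 0) (T : ℝ≥0) :
    μ ({w | ∃ r < T, w r ∈ F} ∩ stayIn C T) = 0 := by
  have := hμ.1
  have := hP.1
  have key : ∀ ε : ℝ≥0, 0 < ε → μ ({w | ∃ r, r + ε < T ∧ w r ∈ F} ∩ stayIn C T) = 0 := by
    intro ε hε
    refine le_antisymm (_root_.le_of_forall_pos_le_add fun η hη => ?_) zero_le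
    rw [zero_add]
    set O : Set (E d) := {z | P (shiftPath z ⁻¹' stayIn C ε) < η} with hOdef
    have hO : IsOpen O := isOpen_setOf_measure_shiftPath_lt (isClosed_stayIn hC ε) η
    let q : ℕ → ℝ≥0 := TopologicalSpace.denseSeq ℝ≥0
    let G : ℕ → Finset ℝ≥0 := fun n => ((Finset.range n).image q).filter fun r => r + ε ≤ T
    have hG : Monotone G := fun m n h =>
      Finset.filter_subset_filter _ (Finset.image_subset_image (Finset.range_mono h))
    have hsub : {w : PathSpace d | ∃ r, r + ε < T ∧ w r ∈ F} ∩ stayIn C T ⊆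
        ⋃ n, ({w | ∃ r ∈ G n, w r ∈ O} ∩ stayIn C T) := by
      rintro w ⟨⟨r, hr, hrF⟩, hw⟩
      have hopen : IsOpen {r : ℝ≥0 | r + ε < T ∧ w r ∈ O} :=
        (isOpen_lt (by fun_prop) continuous_const).inter (hO.preimage w.continuous)
      have hrO : w r ∈ O := by
        change P _ < η
        rw [hF _ hrF ε hε]
        exact hη
      obtain ⟨_, h1, i, rfl⟩ := (TopologicalSpace.denseRange_denseSeq ℝ≥0).inter_open_nonempty _
        hopen ⟨r, hr, hrO⟩
      refine Set.mem_iUnion.2 ⟨i + 1, ⟨q i, ?_, h1.2⟩, hw⟩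
      simp only [G, Finset.mem_filter, Finset.mem_image, Finset.mem_range]
      exact ⟨⟨i, Nat.lt_succ_self i, rfl⟩, h1.1.le⟩
    refine (measure_mono hsub).trans ?_
    rw [Monotone.measure_iUnion]
    · refine iSup_le fun n => ?_
      refine (hμ.measure_exists_mem_finset_le hP hC hO.measurableSet (fun z hz => hz.le) (G n)
        fun r hr => (Finset.mem_filter.1 hr).2).trans ?_
      exact mul_le_of_le_one_right' prob_le_one
    · rintro m n h w ⟨⟨r, hr, hw⟩, hw'⟩
      exact ⟨⟨r, hG h hr, hw⟩, hw'⟩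
  refine measure_mono_null (t := ⋃ n : ℕ,
    ({w : PathSpace d | ∃ r, r + ((n : ℝ≥0) + 1)⁻¹ < T ∧ w r ∈ F} ∩ stayIn C T)) ?_
    (measure_iUnion_null fun n => key _ (by positivity))
  rintro w ⟨⟨r, hr, hw⟩, hw'⟩
  obtain ⟨n, hn⟩ := exists_nat_one_div_lt (K := ℝ) (NNReal.coe_pos.2 (tsub_pos_of_lt hr))
  refine Set.mem_iUnion.2 ⟨n, ⟨r, ?_, hw⟩, hw'⟩
  rw [← lt_tsub_iff_left, ← NNReal.coe_lt_coe]
  simpa using hn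

theorem pi_absolutelyContinuous_fin {n : ℕ} {μ ν : Fin n → Measure ℝ} [∀ i, SigmaFinite (μ i)]
    [∀ i, SigmaFinite (ν i)] (h : ∀ i, μ i ≪ ν i) : Measure.pi μ ≪ Measure.pi ν := by
  induction n with
  | zero => rw [Measure.pi_of_empty μ, Measure.pi_of_empty ν]
  | succ n ih =>
    rw [← ((measurePreserving_piFinSuccAbove μ 0).symm _).map_eq,
      ← ((measurePreserving_piFinSuccAbove ν 0).symm _).map_eq]
    exact ((h 0).prod (ih fun j => h _)).map (MeasurableEquiv.measurable _)

theorem pi_absolutelyContinuous {ι : Type*} [Fintype ι] {μ ν : ι → Measure ℝ}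
    [∀ i, SigmaFinite (μ i)] [∀ i, SigmaFinite (ν i)] (h : ∀ i, μ i ≪ ν i) :
    Measure.pi μ ≪ Measure.pi ν := by
  let e := (Fintype.equivFin ι).symm
  rw [← Measure.pi_map_piCongrLeft e μ, ← Measure.pi_map_piCongrLeft e ν]
  exact (pi_absolutelyContinuous_fin fun i => h (e i)).map (MeasurableEquiv.measurable _)

theorem IsBrownianLaw.exists_map_eval_absolutelyContinuous {d : ℕ} {x : E d}
    {μ : Measure (PathSpace d)} (hμ : IsBrownianLaw x μ) :
    ∃ m : Measure (E d), SFinite m ∧ ∀ δ, 0 < δ → μ.map (fun w => w δ) ≪ m := by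
  let φ : (Fin 1 × Fin d → ℝ) → E d := fun z => x + WithLp.toLp 2 fun c => z (0, c)
  have hφ : Measurable φ := ((WithLp.measurable_toLp 2 _).comp (by fun_prop)).const_add x
  refine ⟨(volume : Measure (Fin 1 × Fin d → ℝ)).map φ, inferInstance, fun δ hδ => ?_⟩
  let t : Fin 2 → ℝ≥0 := ![0, δ]
  have ht : Monotone t := by
    refine Fin.monotone_iff_le_succ.2 fun i => ?_
    have hi : i = 0 := Subsingleton.elim _ _
    subst hi
    exact zero_le
  have h1 : μ.map (fun w => w δ) = (μ.map fun w (p : Fin 1 × Fin d) =>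
      w (t p.1.succ) p.2 - w (t p.1.castSucc) p.2).map φ := by
    rw [Measure.map_map hφ (measurable_increments_s3 t)]
    refine Measure.map_congr ?_
    filter_upwards [hμ.ae_start] with w hw
    ext c
    simp [φ, t, hw]
  rw [h1, hμ.2.2 1 t ht]
  refine Measure.AbsolutelyContinuous.map (pi_absolutelyContinuous fun p => ?_) hφ
  refine gaussianReal_absolutelyContinuous 0 ?_
  have hp : p.1 = 0 := Subsingleton.elim _ _
  simp [hp, t, hδ.ne']

/-- The paths that leave `U` for the first time at time `T`. -/
def firstExitAt {d : ℕ} (U : Set (E d)) (T : ℝ≥0) : Set (PathSpace d) :=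
  {w | (∀ r, 0 < r → r < T → w r ∈ U) ∧ w T ∉ U}

theorem measurableSet_firstExitAt {d : ℕ} {U : Set (E d)} (hU : IsOpen U) (T : ℝ≥0) :
    MeasurableSet (firstExitAt U T) := by
  have : firstExitAt U T = (⋂ n : ℕ, stayIn U (T - ((n : ℝ≥0) + 1)⁻¹)) ∩
      (fun w : PathSpace d => w T) ⁻¹' Uᶜ := by
    ext w
    simp only [firstExitAt, stayIn, Set.mem_ofPred_eq, Set.mem_inter_iff, Set.mem_iInter,
      Set.mem_preimage, Set.mem_compl_iff]
    refine and_congr_left fun _ => ⟨fun h n r h0 hr => h r h0 ?_, fun h r h0 hr => ?_⟩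
    · refine hr.trans_lt (tsub_lt_self ?_ (by positivity))
      exact tsub_pos_iff_lt.1 (h0.trans_le hr) |>.trans' (by positivity)
    · obtain ⟨n, hn⟩ := exists_nat_one_div_lt (K := ℝ) (NNReal.coe_pos.2 (tsub_pos_of_lt hr))
      refine h n r h0 ?_
      refine le_tsub_of_add_le_left ?_
      rw [← le_tsub_iff_right hr.le, ← NNReal.coe_le_coe]
      simpa using hn.le
  rw [this]
  exact (MeasurableSet.iInter fun n => measurableSet_stayIn hU _).inter
    (measurable_path_eval T hU.measurableSet.compl)

theorem IsBrownianLaw.measure_firstExitAt {d : ℕ} {x : E d} {μ P : Measure (PathSpace d)}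
    (hμ : IsBrownianLaw x μ) (hP : IsBrownianLaw 0 P) {U : Set (E d)} (hU : IsOpen U)
    {T : ℝ≥0} (hT : 0 < T) : μ (firstExitAt U T) = 0 := by
  have := hμ.1
  have := hP.1
  obtain ⟨m, hm, hac⟩ := hμ.exists_map_eval_absolutelyContinuous
  have hG : ∀ t, MeasurableSet {p : E d × PathSpace d | shiftPath p.1 p.2 ∈ firstExitAt U t} :=
    fun t => measurable_shiftPath (measurableSet_firstExitAt hU t)
  let A : ℝ → Set (E d × PathSpace d) := fun t =>
    {p | 0 < t ∧ shiftPath p.1 p.2 ∈ firstExitAt U t.toNNReal}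
  have hA : ∀ t, MeasurableSet (A t) := fun t => (MeasurableSet.const _).inter (hG _)
  have hdisj : Pairwise (Function.onFun (AEDisjoint (m.prod P)) A) := by
    have key : ∀ t t', t < t' → Disjoint (A t) (A t') := by
      refine fun t t' htt => Set.disjoint_left.2 ?_
      rintro p ⟨ht, h⟩ ⟨ht', h'⟩
      exact h.2 (h'.1 _ (Real.toNNReal_pos.2 ht) ((Real.toNNReal_lt_toNNReal_iff ht').2 htt))
    intro t t' htt
    rcases htt.lt_or_gt with h | h
    · exact (key t t' h).aedisjoint
    · exact (key t' t h).symm.aedisjoint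
  have hcount := Measure.countable_meas_pos_of_disjoint_iUnion₀ (μ := m.prod P)
    (fun t => (hA t).nullMeasurableSet) hdisj
  obtain ⟨t, ⟨ht0, htT⟩, ht⟩ := (hcount.dense_compl ℝ).inter_open_nonempty (Set.Ioo 0 (T : ℝ))
    isOpen_Ioo (Set.nonempty_Ioo.2 hT)
  simp only [Set.mem_compl_iff, Set.mem_ofPred_eq, not_lt, nonpos_iff_eq_zero] at ht
  have hAt : A t = {p | shiftPath p.1 p.2 ∈ firstExitAt U t.toNNReal} := by
    ext p; simp [A, ht0]
  have hnull := Measure.measure_ae_null_of_prod_null ht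
  lift t to ℝ≥0 using ht0.le
  rw [hAt, Real.toNNReal_coe] at hnull
  have htT' : t < T := by exact_mod_cast htT
  have ht0' : 0 < t := by exact_mod_cast ht0
  have hδ : 0 < T - t := tsub_pos_of_lt htT'
  have hsub : firstExitAt U T ⊆ delayPath (T - t) ⁻¹' firstExitAt U t ∩ Set.univ := by
    rintro w ⟨h1, h2⟩
    refine ⟨⟨fun r h0 hr => h1 _ (by positivity) ?_, ?_⟩, trivial⟩
    · calc T - t + r < T - t + t := by gcongr
        _ = T := tsub_add_cancel_of_le htT'.le
    · rw [delayPath_apply, tsub_add_cancel_of_le htT'.le]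
      exact h2
  refine measure_mono_null hsub ?_
  rw [hμ.measure_inter_delayPath hP MeasurableSet.univ (fun _ _ _ _ => trivial)
    (measurableSet_firstExitAt hU t), Measure.restrict_univ]
  have h3 := (hac _ hδ).ae_le hnull
  have h4 := ae_of_ae_map (measurable_path_eval (T - t)).aemeasurable h3
  rw [lintegral_eq_zero_of_ae_eq_zero]
  exact h4

/-- Almost surely a Brownian path started in `U` either stays in `U` or visits the exterior of `U`,
when Brownian motion started at boundary points leaves the closure instantaneously. -/
theorem ae_stayIn_or_exists_notMem_closure {d : ℕ} {P : Measure (PathSpace d)}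
    (hP : IsBrownianLaw 0 P) {y : E d} {μ : Measure (PathSpace d)} (hμ : IsBrownianLaw y μ)
    {U : Set (E d)} (hU : IsOpen U)
    (hreg : ∀ z ∈ frontier U, ∀ ε, 0 < ε → P (shiftPath z ⁻¹' stayIn (closure U) ε) = 0)
    {T : ℝ≥0} (hT : 0 < T) :
    ∀ᵐ v ∂P, shiftPath y v ∈ stayIn U T ∨ ∃ r, 0 < r ∧ r ≤ T ∧ y + v r ∉ closure U := by
  have h1 : ∀ᵐ w ∂μ, ¬ (w ∈ {w | ∃ r < T, w r ∈ frontier U} ∩ stayIn (closure U) T) :=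
    measure_eq_zero_iff_ae_notMem.1 (hμ.measure_touch_inter_stayIn hP isClosed_closure hreg T)
  have h2 : ∀ᵐ w ∂μ, w ∉ firstExitAt U T :=
    measure_eq_zero_iff_ae_notMem.1 (hμ.measure_firstExitAt hP hU hT)
  have h3 : ∀ᵐ w ∂μ, w ∈ stayIn U T ∨ ∃ r, 0 < r ∧ r ≤ T ∧ w r ∉ closure U := by
    filter_upwards [h1, h2] with w hw1 hw2
    by_contra! hcon
    obtain ⟨hcon1, hcon2⟩ := hcon
    have hcl : w ∈ stayIn (closure U) T := hcon2
    have hfr : ∀ r, 0 < r → r ≤ T → w r ∉ U → w r ∈ frontier U := fun r h0 hr hn => by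
      rw [hU.frontier_eq]
      exact ⟨hcl r h0 hr, hn⟩
    have hlt : ∀ r, 0 < r → r < T → w r ∈ U := by
      intro r h0 hr
      by_contra hn
      exact hw1 ⟨⟨r, hr, hfr r h0 hr.le hn⟩, hcl⟩
    refine hcon1 fun r h0 hr => ?_
    rcases hr.lt_or_eq with h | rfl
    · exact hlt r h0 h
    · by_contra hn
      exact hw2 ⟨hlt, hn⟩
  rw [← hP.map_shiftPath hμ] at h3
  exact ae_of_ae_map (measurable_shiftPath_right y).aemeasurable h3

/-- Expectation of `f` along the Brownian path started at `y`, on the event that the path stays in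
`U` up to time `T`. Here `P` is the law of Brownian motion started at the origin. -/
def killedExp {d : ℕ} (U : Set (E d)) (T : ℝ≥0) (P : Measure (PathSpace d)) (f : PathSpace d → ℝ)
    (y : E d) : ℝ :=
  ∫ v, (stayIn U T).indicator f (shiftPath y v) ∂P

theorem stayIn_add {d : ℕ} {U : Set (E d)} {s : ℝ≥0} (hs : 0 < s) (T : ℝ≥0) :
    stayIn U (s + T) = stayIn U s ∩ delayPath s ⁻¹' stayIn U T := by
  ext w
  constructor
  · intro h
    exact ⟨fun r h0 hr => h r h0 (hr.trans le_self_add),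
      fun r h0 hr => h (s + r) (by positivity) (by gcongr)⟩
  · rintro ⟨h1, h2⟩ r h0 hr
    rcases le_or_gt r s with h | h
    · exact h1 r h0 h
    · have := h2 (r - s) (tsub_pos_of_lt h) (tsub_le_iff_left.2 hr)
      rwa [delayPath_apply, add_tsub_cancel_of_le h.le] at this

theorem continuous_shiftPath_left {d : ℕ} (v : PathSpace d) :
    Continuous fun y : E d => shiftPath y v :=
  ContinuousMap.continuous_of_continuous_uncurry _
    (continuous_fst.add (v.continuous.comp continuous_snd))

theorem norm_indicator_le_of_forall {α : Type*} {f : α → ℝ} {C : ℝ} (hC : ∀ w, ‖f w‖ ≤ C)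
    (s : Set α) (w : α) : ‖s.indicator f w‖ ≤ C :=
  (norm_indicator_le_norm_self f w).trans (hC w)

section Killed

variable {d : ℕ} {U : Set (E d)} {T : ℝ≥0} {P : Measure (PathSpace d)} {f : PathSpace d → ℝ}
  {C : ℝ}

theorem measurable_killedExp [SFinite P] (hU : IsOpen U) (hf : Measurable f) :
    Measurable (killedExp U T P f) :=
  (StronglyMeasurable.integral_prod_right' (f := fun p : E d × PathSpace d =>
    (stayIn U T).indicator f (shiftPath p.1 p.2))
    ((hf.indicator (measurableSet_stayIn hU T)).comp
      measurable_shiftPath).stronglyMeasurable).measurable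

theorem integrable_killed [IsProbabilityMeasure P] (hU : IsOpen U) (hf : Measurable f)
    (hC : ∀ w, ‖f w‖ ≤ C) (y : E d) :
    Integrable (fun v => (stayIn U T).indicator f (shiftPath y v)) P :=
  Integrable.of_bound (((hf.indicator (measurableSet_stayIn hU T)).comp
    (measurable_shiftPath_right y)).aestronglyMeasurable) C
    (ae_of_all _ fun _ => norm_indicator_le_of_forall hC _ _)

theorem abs_killedExp_le [IsProbabilityMeasure P] (hU : IsOpen U)
    (hC : ∀ w, ‖f w‖ ≤ C) (y : E d) :
    |killedExp U T P f y| ≤ C * killedExp U T P (fun _ => 1) y := by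
  rw [killedExp, killedExp, ← integral_const_mul, ← Real.norm_eq_abs]
  refine norm_integral_le_of_norm_le ((integrable_killed hU measurable_const
    (fun _ => le_of_eq norm_one) y).const_mul C) (ae_of_all _ fun v => ?_)
  by_cases h : shiftPath y v ∈ stayIn U T
  · simpa [h] using hC _
  · simp [h]

theorem killedExp_eq_zero (hP : IsBrownianLaw 0 P) (hT : 0 < T) {y : E d} (hy : y ∉ closure U) :
    killedExp U T P f y = 0 := by
  refine integral_eq_zero_of_ae ?_
  filter_upwards [hP.ae_start] with v hv
  refine Set.indicator_of_notMem (fun h => hy ?_) _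
  have hlim : Tendsto (fun r => shiftPath y v r) (𝓝[>] 0) (𝓝 y) := by
    have := ((shiftPath y v).continuous.tendsto 0).mono_left (nhdsWithin_le_nhds (s := Set.Ioi 0))
    rwa [shiftPath_apply, hv, add_zero] at this
  refine mem_closure_of_tendsto hlim ?_
  filter_upwards [Ioc_mem_nhdsGT hT] with r hr
  exact h r hr.1 hr.2

theorem continuousAt_killedExp (hP : IsBrownianLaw 0 P) {μ : Measure (PathSpace d)} {y : E d}
    (hμ : IsBrownianLaw y μ) (hU : IsOpen U)
    (hreg : ∀ z ∈ frontier U, ∀ ε, 0 < ε → P (shiftPath z ⁻¹' stayIn (closure U) ε) = 0)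
    (hT : 0 < T) (hf : Continuous f) (hC : ∀ w, ‖f w‖ ≤ C) (hy : y ∈ U) :
    ContinuousAt (killedExp U T P f) y := by
  have := hP.1
  refine tendsto_integral_filter_of_dominated_convergence (fun _ => C)
    (Eventually.of_forall fun z => (integrable_killed hU hf.measurable hC z).1)
    (Eventually.of_forall fun z => ae_of_all _ fun v => norm_indicator_le_of_forall hC _ _)
    (integrable_const _) ?_
  filter_upwards [hP.ae_start, ae_stayIn_or_exists_notMem_closure hP hμ hU hreg hT] with v hv hor
  have hcont := continuous_shiftPath_left v
  rcases hor with h | ⟨r, h0, hr, hn⟩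
  · rw [Set.indicator_of_mem h]
    refine ((hf.comp hcont).tendsto y).congr' ?_
    have hopen : IsOpen {w : PathSpace d | Set.MapsTo w (Set.Icc 0 T) U} :=
      ContinuousMap.isOpen_setOfPred_mapsTo isCompact_Icc hU
    have hmem : shiftPath y v ∈ {w : PathSpace d | Set.MapsTo w (Set.Icc 0 T) U} := by
      intro r hr
      rcases eq_or_ne r 0 with rfl | h0
      · simpa [shiftPath_apply, hv] using hy
      · exact h r (pos_iff_ne_zero.2 h0) hr.2
    filter_upwards [hcont.continuousAt.preimage_mem_nhds (hopen.mem_nhds hmem)] with z hz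
    have hz' : shiftPath z v ∈ stayIn U T := fun r _ hr => hz ⟨zero_le, hr⟩
    exact (Set.indicator_of_mem hz' f).symm
  · have hev : ∀ᶠ z in 𝓝 y, z + v r ∉ closure U :=
      (continuous_id.add continuous_const).continuousAt.eventually
        (isClosed_closure.isOpen_compl.mem_nhds hn)
    have hzero : ∀ z, z + v r ∉ closure U → (stayIn U T).indicator f (shiftPath z v) = 0 :=
      fun z hz => Set.indicator_of_notMem
        (fun h : shiftPath z v ∈ stayIn U T => hz (subset_closure (h r h0 hr))) f
    rw [hzero y hn]
    refine tendsto_const_nhds.congr' ?_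
    filter_upwards [hev] with z hz
    exact (hzero z hz).symm

theorem killedExp_one_pos (hP : IsBrownianLaw 0 P) (hU : IsOpen U) {y : E d} (hy : y ∈ U) :
    0 < killedExp U T P (fun _ => 1) y := by
  have := hP.1
  obtain ⟨ρ, hρ, hball⟩ := Metric.isOpen_iff.1 hU y hy
  have hpos := measure_forall_norm_lt_pos hP T hρ
  have hsub : {w : PathSpace d | ∀ r ≤ T, ‖w r‖ < ρ} ⊆ shiftPath y ⁻¹' stayIn U T := by
    intro w hw r _ hr
    apply hball
    simpa [shiftPath_apply] using hw r hr
  have hm : MeasurableSet (shiftPath y ⁻¹' stayIn U T) :=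
    measurable_shiftPath_right y (measurableSet_stayIn hU T)
  have : killedExp U T P (fun _ => 1) y = P.real (shiftPath y ⁻¹' stayIn U T) := by
    rw [← integral_indicator_one hm]
    rfl
  rw [this]
  exact ENNReal.toReal_pos (hpos.trans_le (measure_mono hsub)).ne' (measure_ne_top _ _)

theorem killedExp_comp_start (hP : IsBrownianLaw 0 P) (φ : E d → ℝ) (y : E d) :
    killedExp U T P (fun w => φ (w 0)) y = φ y * killedExp U T P (fun _ => 1) y := by
  rw [killedExp, killedExp, ← integral_const_mul]
  refine integral_congr_ae ?_
  filter_upwards [hP.ae_start] with v hv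
  by_cases h : shiftPath y v ∈ stayIn U T
  · simp [h, shiftPath_apply, hv]
  · simp [h]

/-- The Markov property for Brownian motion killed on leaving `U`. -/
theorem IsBrownianLaw.setIntegral_delayPath {x : E d} {μ : Measure (PathSpace d)}
    (hμ : IsBrownianLaw x μ) (hP : IsBrownianLaw 0 P) (hU : IsOpen U) {s : ℝ≥0} (hs : 0 < s)
    (hf : Measurable f) (hC : ∀ w, ‖f w‖ ≤ C) :
    ∫ w in stayIn U (s + T), f (delayPath s w) ∂μ =
      ∫ u in stayIn U s, killedExp U T P f (u s) ∂μ := by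
  have := hμ.1
  have := hP.1
  have hg : Measurable ((stayIn U T).indicator f) := hf.indicator (measurableSet_stayIn hU T)
  have hmap := hμ.map_delayPath hP (measurableSet_stayIn hU s)
    (fun u v huv hu r h0 hr => huv r hr ▸ hu r h0 hr)
  have h1 : ∫ w in stayIn U (s + T), f (delayPath s w) ∂μ =
      ∫ w, (stayIn U T).indicator f w ∂((μ.restrict (stayIn U s)).map (delayPath s)) := by
    rw [integral_map (measurable_delayPath s).aemeasurable hg.aestronglyMeasurable, stayIn_add hs,
      Set.inter_comm, ← Measure.restrict_restrict
        (measurable_delayPath s (measurableSet_stayIn hU T)),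
      ← integral_indicator (measurable_delayPath s (measurableSet_stayIn hU T))]
    rfl
  rw [h1, hmap, integral_map (measurable_shiftPath_eval s).aemeasurable hg.aestronglyMeasurable,
    integral_prod]
  · rfl
  · exact Integrable.of_bound (hg.comp (measurable_shiftPath_eval s)).aestronglyMeasurable C
      (ae_of_all _ fun _ => norm_indicator_le_of_forall hC _ _)

end Killed

/-- Expectation of `f` along the Brownian path started at `y` conditioned to stay in `U` up to
time `T`, with the value `0` when the conditioning event is null. -/
def survivalExp {d : ℕ} (U : Set (E d)) (T : ℝ≥0) (P : Measure (PathSpace d)) (f : PathSpace d → ℝ)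
    (y : E d) : ℝ :=
  killedExp U T P f y / killedExp U T P (fun _ => 1) y

section Survival

variable {d : ℕ} {U : Set (E d)} {T : ℝ≥0} {P : Measure (PathSpace d)} {f : PathSpace d → ℝ}
  {C : ℝ}

theorem killedExp_one_nonneg (y : E d) : 0 ≤ killedExp U T P (fun _ => 1) y :=
  integral_nonneg fun _ => Set.indicator_nonneg (fun _ _ => zero_le_one) _

theorem survivalExp_mul [IsProbabilityMeasure P] (hU : IsOpen U) (hC : ∀ w, ‖f w‖ ≤ C) (y : E d) :
    survivalExp U T P f y * killedExp U T P (fun _ => 1) y = killedExp U T P f y := by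
  refine div_mul_cancel_of_imp fun h => ?_
  have := abs_killedExp_le (T := T) (P := P) hU hC y
  rw [h, mul_zero] at this
  exact abs_nonpos_iff.1 this

theorem abs_survivalExp_le [IsProbabilityMeasure P] (hU : IsOpen U) (hC : ∀ w, ‖f w‖ ≤ C)
    (y : E d) : |survivalExp U T P f y| ≤ C := by
  have hC0 : 0 ≤ C := (norm_nonneg _).trans (hC 0)
  rw [survivalExp, abs_div, abs_of_nonneg (killedExp_one_nonneg y)]
  exact div_le_of_le_mul₀ (killedExp_one_nonneg y) hC0 (abs_killedExp_le hU hC y)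

theorem measurable_survivalExp [SFinite P] (hU : IsOpen U) (hf : Measurable f) :
    Measurable (survivalExp U T P f) :=
  (measurable_killedExp hU hf).div (measurable_killedExp hU measurable_const)

theorem continuousAt_survivalExp (hP : IsBrownianLaw 0 P) {μ : Measure (PathSpace d)} {y : E d}
    (hμ : IsBrownianLaw y μ) (hU : IsOpen U)
    (hreg : ∀ z ∈ frontier U, ∀ ε, 0 < ε → P (shiftPath z ⁻¹' stayIn (closure U) ε) = 0)
    (hT : 0 < T) (hf : Continuous f) (hC : ∀ w, ‖f w‖ ≤ C) (hy : y ∉ frontier U) :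
    ContinuousAt (survivalExp U T P f) y := by
  by_cases hyU : y ∈ U
  · exact (continuousAt_killedExp hP hμ hU hreg hT hf hC hyU).div
      (continuousAt_killedExp hP hμ hU hreg hT continuous_const (fun _ => norm_one.le) hyU)
      (killedExp_one_pos hP hU hyU).ne'
  · have hcl : y ∉ closure U := fun h => hy (hU.frontier_eq ▸ ⟨h, hyU⟩)
    refine (continuousAt_const (y := (0 : ℝ))).congr ?_
    filter_upwards [isClosed_closure.isOpen_compl.mem_nhds hcl] with z hz
    rw [survivalExp, killedExp_eq_zero hP hT hz, zero_div]

/-- On the event of staying in `U`, the path after time `s` can be replaced by its conditional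
expectation given the position at time `s`. -/
theorem IsBrownianLaw.setIntegral_delayPath_eq_survivalExp {x : E d} {μ : Measure (PathSpace d)}
    (hμ : IsBrownianLaw x μ) (hP : IsBrownianLaw 0 P) (hU : IsOpen U) {s : ℝ≥0} (hs : 0 < s)
    (hf : Measurable f) (hC : ∀ w, ‖f w‖ ≤ C) :
    ∫ w in stayIn U (s + T), f (delayPath s w) ∂μ =
      ∫ w in stayIn U (s + T), survivalExp U T P f (w s) ∂μ := by
  have := hP.1
  have h := hμ.setIntegral_delayPath (T := T) hP hU hs
    ((measurable_survivalExp (T := T) (P := P) hU hf).comp (measurable_path_eval 0))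
    (fun w => abs_survivalExp_le hU hC (w 0))
  simp only [Function.comp_apply, delayPath_apply, add_zero] at h
  rw [h, hμ.setIntegral_delayPath hP hU hs hf hC]
  congr 1
  ext u
  exact ((killedExp_comp_start hP _ _).trans (survivalExp_mul hU hC _)).symm

/-- The density with respect to Brownian motion of its law conditioned to stay in `U`. -/
def survivalDensity {d : ℕ} (U : Set (E d)) (T : ℝ≥0) (P : Measure (PathSpace d))
    (p : E d × PathSpace d) : ℝ≥0 :=
  Real.toNNReal ((stayIn U T).indicator (fun _ => (1 : ℝ)) (shiftPath p.1 p.2) /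
    killedExp U T P (fun _ => 1) p.1)

/-- The law of Brownian motion with initial distribution `μ`, conditioned to stay in `U` up to
time `T` given its starting point. -/
def survivalLaw {d : ℕ} (U : Set (E d)) (T : ℝ≥0) (P : Measure (PathSpace d))
    (μ : Measure (E d)) : Measure (PathSpace d) :=
  ((μ.prod P).withDensity fun p => survivalDensity U T P p).map fun p => shiftPath p.1 p.2

theorem measurable_survivalDensity [SFinite P] (hU : IsOpen U) :
    Measurable (survivalDensity U T P) :=
  (((measurable_const.indicator (measurableSet_stayIn hU T)).comp measurable_shiftPath).div
    ((measurable_killedExp hU measurable_const).comp measurable_fst)).real_toNNReal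

theorem survivalDensity_smul (p : E d × PathSpace d) :
    survivalDensity U T P p • f (shiftPath p.1 p.2) =
      (stayIn U T).indicator f (shiftPath p.1 p.2) / killedExp U T P (fun _ => 1) p.1 := by
  rw [survivalDensity, NNReal.smul_def, Real.coe_toNNReal _ (div_nonneg
    (Set.indicator_nonneg (fun _ _ => zero_le_one) _) (killedExp_one_nonneg _)), smul_eq_mul]
  by_cases h : shiftPath p.1 p.2 ∈ stayIn U T
  · simp [h]; ring
  · simp [h]

theorem integral_survivalLaw [IsProbabilityMeasure P] {μ : Measure (E d)} [IsFiniteMeasure μ]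
    (hU : IsOpen U) (hf : Measurable f) (hC : ∀ w, ‖f w‖ ≤ C) :
    ∫ w, f w ∂(survivalLaw U T P μ) = ∫ y, survivalExp U T P f y ∂μ := by
  have hm : Measurable fun p : E d × PathSpace d =>
      (stayIn U T).indicator f (shiftPath p.1 p.2) / killedExp U T P (fun _ => 1) p.1 :=
    ((hf.indicator (measurableSet_stayIn hU T)).comp measurable_shiftPath).div
      ((measurable_killedExp hU measurable_const).comp measurable_fst)
  rw [survivalLaw, integral_map measurable_shiftPath.aemeasurable hf.aestronglyMeasurable,
    integral_withDensity_eq_integral_smul (measurable_survivalDensity hU)]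
  simp only [survivalDensity_smul]
  rw [integral_prod]
  · simp only [integral_div]
    rfl
  · rw [integrable_prod_iff hm.aestronglyMeasurable]
    refine ⟨ae_of_all _ fun y =>
      (integrable_killed hU hf hC y).div_const (killedExp U T P (fun _ => 1) y), ?_⟩
    have hnorm : ∀ y, ∫ v, ‖(stayIn U T).indicator f (shiftPath y v) /
        killedExp U T P (fun _ => 1) y‖ ∂P = survivalExp U T P (fun w => ‖f w‖) y := by
      intro y
      simp only [norm_div, integral_div, Real.norm_of_nonneg (killedExp_one_nonneg _),
        norm_indicator_eq_indicator_norm]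
      rfl
    simp only [hnorm]
    exact Integrable.of_bound (measurable_survivalExp hU hf.norm).aestronglyMeasurable C
      (ae_of_all _ fun y => abs_survivalExp_le hU (fun w => (norm_norm _).trans_le (hC w)) y)

end Survival

/-- Weak convergence tests bounded functions whose discontinuities lie in a closed null set. -/
theorem tendsto_integral_of_continuousAt_compl {ι X : Type*} [PseudoMetricSpace X]
    [MeasurableSpace X] [BorelSpace X] {l : Filter ι} {ν : ι → Measure X}
    [∀ i, IsFiniteMeasure (ν i)] {μ : Measure X} [IsFiniteMeasure μ]
    (hν : ∀ g : BoundedContinuousFunction X ℝ,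
      Tendsto (fun i => ∫ y, g y ∂(ν i)) l (𝓝 (∫ y, g y ∂μ)))
    {F : Set X} (hF : IsClosed F) (hne : F.Nonempty) (hμF : μ F = 0) {q : X → ℝ}
    (hq : Measurable q) {C : ℝ} (hC : ∀ y, |q y| ≤ C) (hcont : ∀ y ∉ F, ContinuousAt q y) :
    Tendsto (fun i => ∫ y, q y ∂(ν i)) l (𝓝 (∫ y, q y ∂μ)) := by
  let χ : ℕ → X → ℝ := fun n y => min 1 (n * Metric.infDist y F)
  have hχc : ∀ n, Continuous (χ n) := fun n =>
    continuous_const.min (continuous_const.mul (Metric.continuous_infDist_pt F))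
  have hχ0 : ∀ n y, 0 ≤ χ n y := fun n y =>
    le_min zero_le_one (mul_nonneg n.cast_nonneg Metric.infDist_nonneg)
  have hχ1 : ∀ n y, χ n y ≤ 1 := fun n y => min_le_left _ _
  have hχF : ∀ n, ∀ y ∈ F, χ n y = 0 := fun n y hy => by
    simp [χ, Metric.infDist_zero_of_mem hy]
  have hqχc : ∀ n, Continuous fun y => q y * χ n y := by
    intro n
    refine continuous_iff_continuousAt.2 fun y => ?_
    by_cases hy : y ∈ F
    · have h1 : Tendsto (fun z => C * χ n z) (𝓝 y) (𝓝 0) := by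
        have := ((hχc n).tendsto y).const_mul C
        rwa [hχF n y hy, mul_zero] at this
      have h2 : Tendsto (fun z => q z * χ n z) (𝓝 y) (𝓝 0) := by
        refine squeeze_zero_norm (fun z => ?_) h1
        rw [norm_mul, Real.norm_of_nonneg (hχ0 n z)]
        exact mul_le_mul_of_nonneg_right (hC z) (hχ0 n z)
      rw [ContinuousAt, hχF n y hy, mul_zero]
      exact h2
    · exact (hcont y hy).mul (hχc n).continuousAt
  let a : ℕ → BoundedContinuousFunction X ℝ := fun n =>
    BoundedContinuousFunction.ofNormedAddCommGroup (fun y => q y * χ n y) (hqχc n) C fun y => by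
      rw [norm_mul, Real.norm_of_nonneg (hχ0 n y)]
      exact (mul_le_of_le_one_right (norm_nonneg _) (hχ1 n y)).trans (hC y)
  let b : ℕ → BoundedContinuousFunction X ℝ := fun n =>
    BoundedContinuousFunction.ofNormedAddCommGroup (fun y => C * (1 - χ n y))
      (continuous_const.mul (continuous_const.sub (hχc n))) |C| fun y => by
      rw [norm_mul, Real.norm_of_nonneg (sub_nonneg.2 (hχ1 n y))]
      exact mul_le_of_le_one_right (norm_nonneg _) (sub_le_self _ (hχ0 n y))
  have hdiff : ∀ (κ : Measure X) [IsFiniteMeasure κ] (n : ℕ),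
      |∫ y, q y ∂κ - ∫ y, a n y ∂κ| ≤ ∫ y, b n y ∂κ := by
    intro κ _ n
    have hqi : Integrable q κ := Integrable.of_bound hq.aestronglyMeasurable C (ae_of_all _ hC)
    rw [← integral_sub hqi ((a n).integrable κ), ← Real.norm_eq_abs]
    refine norm_integral_le_of_norm_le ((b n).integrable κ) (ae_of_all _ fun y => ?_)
    change ‖q y - q y * χ n y‖ ≤ C * (1 - χ n y)
    rw [← mul_one_sub, norm_mul, Real.norm_of_nonneg (sub_nonneg.2 (hχ1 n y))]
    exact mul_le_mul_of_nonneg_right (hC y) (sub_nonneg.2 (hχ1 n y))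
  have hb : Tendsto (fun n => ∫ y, b n y ∂μ) atTop (𝓝 0) := by
    rw [← integral_zero X ℝ (μ := μ)]
    refine tendsto_integral_of_dominated_convergence (fun _ => |C|)
      (fun n => (b n).continuous.aestronglyMeasurable) (integrable_const _)
      (fun n => ae_of_all _ fun y => ?_) ?_
    · change ‖C * (1 - χ n y)‖ ≤ |C|
      rw [norm_mul, Real.norm_of_nonneg (sub_nonneg.2 (hχ1 n y))]
      exact mul_le_of_le_one_right (norm_nonneg _) (sub_le_self _ (hχ0 n y))
    · filter_upwards [measure_eq_zero_iff_ae_notMem.1 hμF] with y hy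
      have hpos : 0 < Metric.infDist y F := (hF.notMem_iff_infDist_pos hne).1 hy
      obtain ⟨N, hN⟩ := exists_nat_ge (Metric.infDist y F)⁻¹
      refine tendsto_const_nhds.congr' ?_
      filter_upwards [eventually_ge_atTop N] with n hn
      have : 1 ≤ (n : ℝ) * Metric.infDist y F := by
        rw [← inv_le_iff_one_le_mul₀ hpos]
        exact hN.trans (by exact_mod_cast hn)
      change 0 = C * (1 - χ n y)
      simp [χ, this]
  refine Metric.tendsto_nhds.2 fun ε hε => ?_
  obtain ⟨n, hn⟩ := (hb.eventually_lt_const (by positivity : (0 : ℝ) < ε / 4)).exists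
  filter_upwards [(hν (b n)).eventually_lt_const hn,
    Metric.tendsto_nhds.1 (hν (a n)) (ε / 4) (by positivity)] with i hi1 hi2
  have h1 := hdiff (ν i) n
  have h2 := hdiff μ n
  rw [Real.dist_eq] at hi2 ⊢
  rw [abs_le] at h1 h2
  rw [abs_lt] at hi2 ⊢
  constructor <;> linarith [h1.1, h1.2, h2.1, h2.2, hi2.1, hi2.2]

/-- **Convergence of finite-dimensional distributions** (Proposition 2.3): let `U` be open
and co-regular and `x₀ ∈ ∂U`. If for every `t ∈ (0,1)` the first transition law
`W̃^U_{x,1}(X_t ∈ ·)` converges weakly, as `x ∈ U → x₀`, to a probability measure charging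
no mass to `∂U`, then all finite-dimensional distributions of `W̃^U_{x,1}` converge weakly
as `x ∈ U → x₀`. -/
theorem fdd_convergence_criterion {d : ℕ}
    (W : E d → Measure (PathSpace d)) (hW : IsWiener W)
    (U : Set (E d)) (hU : IsOpen U) (hreg : IsCoRegular W U)
    (x₀ : E d) (hx₀ : x₀ ∈ frontier U)
    (hyp : ∀ t : ℝ≥0, 0 < t → t < 1 →
      ∃ μ : Measure (E d), IsProbabilityMeasure μ ∧ μ (frontier U) = 0 ∧
        ∀ g : BoundedContinuousFunction (E d) ℝ,
          Tendsto (fun x : E d => ∫ y, g y ∂((condLaw W U x).map (fun w => w t)))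
            (𝓝[U] x₀) (𝓝 (∫ y, g y ∂μ))) :
    ∀ (k : ℕ) (t : Fin k → ℝ≥0), StrictMono t → (∀ i, 0 < t i) → (∀ i, t i ≤ 1) →
      ∃ μ : Measure (Fin k → E d), IsProbabilityMeasure μ ∧
        ∀ g : BoundedContinuousFunction (Fin k → E d) ℝ,
          Tendsto (fun x : E d =>
              ∫ v, g v ∂((condLaw W U x).map (fun w (i : Fin k) => w (t i))))
            (𝓝[U] x₀) (𝓝 (∫ v, g v ∂μ)) := by
  intro k t _ ht0 ht1
  have hP : IsBrownianLaw 0 (W 0) := hW 0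
  have hP1 := hP.1
  have hregP : ∀ z ∈ frontier U, ∀ ε, 0 < ε →
      W 0 (shiftPath z ⁻¹' stayIn (closure U) ε) = 0 := by
    intro z hz ε hε
    rw [← Measure.map_apply (measurable_shiftPath_right z)
      (isClosed_stayIn isClosed_closure ε).measurableSet, hP.map_shiftPath (hW z)]
    exact measure_mono_null (stayIn_subset_exitTime_pos _ hε) (hreg z hz)
  obtain ⟨s, hs0, hs1, hst⟩ : ∃ s : ℝ≥0, 0 < s ∧ s < 1 ∧ ∀ i, s ≤ t i := by
    have h1 : ∀ᶠ s : ℝ≥0 in 𝓝[>] 0, ∀ i, s ≤ t i := eventually_all.2 fun i => by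
      filter_upwards [Ioc_mem_nhdsGT (ht0 i)] with s hs using hs.2
    have h2 : ∀ᶠ s : ℝ≥0 in 𝓝[>] 0, s ∈ Set.Ioo (0 : ℝ≥0) 1 := Ioo_mem_nhdsGT one_pos
    obtain ⟨s, hs, hs'⟩ := (h1.and h2).exists
    exact ⟨s, hs'.1, hs'.2, hs⟩
  obtain ⟨m, hm, hmF, hconv⟩ := hyp s hs0 hs1
  set T : ℝ≥0 := 1 - s with hTdef
  have hT : 0 < T := tsub_pos_of_lt hs1
  have hsT : s + T = 1 := add_tsub_cancel_of_le hs1.le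
  have hfin : ∀ x, IsFiniteMeasure (condLaw W U x) := fun x => by
    unfold condLaw; infer_instance
  have hmarkov : ∀ (f : PathSpace d → ℝ) (C : ℝ), Measurable f → (∀ w, ‖f w‖ ≤ C) → ∀ x,
      ∫ w, f (delayPath s w) ∂(condLaw W U x) =
        ∫ y, survivalExp U T (W 0) f y ∂((condLaw W U x).map fun w => w s) := by
    intro f C hf hC x
    rw [integral_map (measurable_path_eval s).aemeasurable
      (measurable_survivalExp hU hf).aestronglyMeasurable, condLaw, ProbabilityTheory.cond,
      integral_smul_measure, integral_smul_measure, setOf_one_lt_exitTime hU, ← hsT,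
      IsBrownianLaw.setIntegral_delayPath_eq_survivalExp (hW x) hP hU hs0 hf hC]
  have hlim : ∀ (f : PathSpace d → ℝ) (C : ℝ), Continuous f → (∀ w, ‖f w‖ ≤ C) →
      Tendsto (fun x => ∫ w, f (delayPath s w) ∂(condLaw W U x)) (𝓝[U] x₀)
        (𝓝 (∫ w, f w ∂(survivalLaw U T (W 0) m))) := by
    intro f C hf hC
    rw [integral_survivalLaw hU hf.measurable hC]
    simp only [hmarkov f C hf.measurable hC]
    exact tendsto_integral_of_continuousAt_compl hconv isClosed_frontier ⟨x₀, hx₀⟩ hmF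
      (measurable_survivalExp hU hf.measurable) (abs_survivalExp_le hU hC)
      fun y hy => continuousAt_survivalExp hP (hW y) hU hregP hT hf hC hy
  have hprob : IsProbabilityMeasure (survivalLaw U T (W 0) m) := by
    have hne : (𝓝[U] x₀).NeBot := mem_closure_iff_nhdsWithin_neBot.1 (frontier_subset_closure hx₀)
    have h1 := hlim (fun _ => 1) 1 continuous_const fun _ => norm_one.le
    have h2 := hconv (BoundedContinuousFunction.const _ 1)
    have hmass : ∀ x, ∫ y, BoundedContinuousFunction.const (E d) (1 : ℝ) y
        ∂((condLaw W U x).map fun w => w s) = ∫ _, (1 : ℝ) ∂(condLaw W U x) := fun x => by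
      rw [integral_map (measurable_path_eval s).aemeasurable
        (BoundedContinuousFunction.continuous _).aestronglyMeasurable]
      rfl
    simp only [hmass] at h2
    have h3 := tendsto_nhds_unique h1 h2
    simp only [BoundedContinuousFunction.const_apply, integral_const, smul_eq_mul, mul_one,
      probReal_univ] at h3
    exact ⟨(ENNReal.toReal_eq_one_iff _).1 h3⟩
  have hcont : Continuous fun (w : PathSpace d) (i : Fin k) => w (t i - s) :=
    continuous_pi fun i => continuous_eval_const _
  refine ⟨(survivalLaw U T (W 0) m).map fun w i => w (t i - s),
    Measure.isProbabilityMeasure_map hcont.measurable.aemeasurable, fun g => ?_⟩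
  have hcont' : Continuous fun (w : PathSpace d) (i : Fin k) => w (t i) :=
    continuous_pi fun i => continuous_eval_const _
  have h := hlim (fun w => g fun i => w (t i - s)) ‖g‖ (g.continuous.comp hcont)
    fun w => g.norm_coe_le_norm _
  simp only [delayPath_apply, add_tsub_cancel_of_le (hst _)] at h
  rw [integral_map hcont.measurable.aemeasurable g.continuous.aestronglyMeasurable]
  refine h.congr fun x => ?_
  rw [integral_map hcont'.measurable.aemeasurable g.continuous.aestronglyMeasurable]

end
end
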